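/- arXiv:0911.3913 — 4 statements merged into one kernel-verified Lean document; each statement's English description precedes it below -/
import Mathlib

section
/- The Painlevé-II equation 4ν''(y) + y ν(y) − ν(y)³ = 0 on ℝ admits a unique solution ν₀ ∈ C^∞(ℝ) such that ν₀(y)/y^{1/2} → 1 as y → +∞ and ν₀(y) → 0 as y → −∞. Moreover this solution ν₀ is strictly increasing on ℝ and its second derivative ν₀'' has exactly one zero on ℝ (an inflection point of ν₀). -/
open Filter Real

namespace PainleveII
open Set Topology NNReal

/-! ### Elementary calculus -/

lemma exists_first_zero {f : ℝ → ℝ} {a b : ℝ} (hab : a ≤ b) (hf : ContinuousOn f (Icc a b))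
    (ha : f a < 0) (hb : 0 ≤ f b) :
    ∃ c ∈ Ioc a b, f c = 0 ∧ ∀ y ∈ Ico a c, f y < 0 := by
  have hcl : IsClosed (Icc a b ∩ f ⁻¹' Ici 0) := hf.preimage_isClosed_of_isClosed isClosed_Icc
    isClosed_Ici
  have hne : (Icc a b ∩ f ⁻¹' Ici 0).Nonempty := ⟨b, ⟨hab, le_rfl⟩, hb⟩
  have hbd : BddBelow (Icc a b ∩ f ⁻¹' Ici 0) := ⟨a, fun y hy => hy.1.1⟩
  set c := sInf (Icc a b ∩ f ⁻¹' Ici 0)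
  have hc : c ∈ Icc a b ∩ f ⁻¹' Ici 0 := hcl.csInf_mem hne hbd
  have hlt : ∀ y ∈ Ico a c, f y < 0 := by
    intro y hy
    by_contra! h
    exact absurd (csInf_le hbd ⟨⟨hy.1, hy.2.le.trans hc.1.2⟩, h⟩) (not_le.2 hy.2)
  have hac : a < c := lt_of_le_of_ne hc.1.1 (by
    intro h
    have := hc.2
    rw [← h] at this
    exact absurd this (not_le.2 ha))
  refine ⟨c, ⟨hac, hc.1.2⟩, le_antisymm ?_ hc.2, hlt⟩
  by_contra! h
  obtain ⟨z, hz, hz0⟩ := intermediate_value_Ioo hac.le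
    (hf.mono (Icc_subset_Icc_right hc.1.2)) ⟨ha, h⟩
  exact absurd hz0 (hlt z ⟨hz.1.le, hz.2⟩).ne

lemma add_mul_sub_le {f f' : ℝ → ℝ} {a b m : ℝ} (hab : a ≤ b)
    (hf : ∀ y ∈ Icc a b, HasDerivAt f (f' y) y) (hm : ∀ y ∈ Ioo a b, m ≤ f' y) :
    f a + m * (b - a) ≤ f b := by
  rcases hab.eq_or_lt with rfl | h
  · simp
  obtain ⟨c, hc, hc'⟩ := exists_hasDerivAt_eq_slope f f' h
    (fun y hy => (hf y hy).continuousAt.continuousWithinAt)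
    (fun y hy => hf y (Ioo_subset_Icc_self hy))
  have h1 := hm c hc
  rw [hc', le_div_iff₀ (sub_pos.2 h)] at h1
  linarith

lemma le_add_mul_sub {f f' : ℝ → ℝ} {a b m : ℝ} (hab : a ≤ b)
    (hf : ∀ y ∈ Icc a b, HasDerivAt f (f' y) y) (hm : ∀ y ∈ Ioo a b, f' y ≤ m) :
    f b ≤ f a + m * (b - a) := by
  have := add_mul_sub_le (f := fun y => -f y) (f' := fun y => -f' y) (m := -m) hab
    (fun y hy => (hf y hy).neg) (fun y hy => neg_le_neg (hm y hy))
  linarith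

lemma le_of_hasDerivAt_nonneg {f f' : ℝ → ℝ} {a b : ℝ} (hab : a ≤ b)
    (hf : ∀ y ∈ Icc a b, HasDerivAt f (f' y) y) (hm : ∀ y ∈ Ioo a b, 0 ≤ f' y) :
    f a ≤ f b := by
  simpa using add_mul_sub_le hab hf hm

lemma ge_of_hasDerivAt_nonpos {f f' : ℝ → ℝ} {a b : ℝ} (hab : a ≤ b)
    (hf : ∀ y ∈ Icc a b, HasDerivAt f (f' y) y) (hm : ∀ y ∈ Ioo a b, f' y ≤ 0) :
    f b ≤ f a := by
  simpa using le_add_mul_sub hab hf hm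

lemma lt_of_hasDerivAt_pos {f f' : ℝ → ℝ} {a b : ℝ} (hab : a < b)
    (hf : ∀ y ∈ Icc a b, HasDerivAt f (f' y) y) (hm : ∀ y ∈ Ioo a b, 0 < f' y) :
    f a < f b := by
  obtain ⟨c, hc, hc'⟩ := exists_hasDerivAt_eq_slope f f' hab
    (fun y hy => (hf y hy).continuousAt.continuousWithinAt)
    (fun y hy => hf y (Ioo_subset_Icc_self hy))
  have h1 := hm c hc
  rw [hc', lt_div_iff₀ (sub_pos.2 hab)] at h1
  linarith

lemma eventually_lt_right {f : ℝ → ℝ} {d c : ℝ} (hf : HasDerivAt f d c) (hd : d < 0) :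
    ∀ᶠ y in 𝓝[>] c, f y < f c := by
  have h := hasDerivAt_iff_tendsto_slope.1 hf
  have h2 : ∀ᶠ y in 𝓝[>] c, slope f c y < 0 :=
    (h.mono_left (nhdsWithin_mono _ fun y hy => ne_of_gt hy)).eventually_lt_const hd
  filter_upwards [h2, self_mem_nhdsWithin] with y hy hyc
  rw [slope_def_field, div_neg_iff] at hy
  have : c < y := hyc
  rcases hy with hy | hy <;> linarith [hy.1, hy.2]

lemma eventually_gt_left {f : ℝ → ℝ} {d c : ℝ} (hf : HasDerivAt f d c) (hd : d < 0) :
    ∀ᶠ y in 𝓝[<] c, f c < f y := by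
  have h := hasDerivAt_iff_tendsto_slope.1 hf
  have h2 : ∀ᶠ y in 𝓝[<] c, slope f c y < 0 :=
    (h.mono_left (nhdsWithin_mono _ fun y hy => ne_of_lt hy)).eventually_lt_const hd
  filter_upwards [h2, self_mem_nhdsWithin] with y hy hyc
  rw [slope_def_field, div_neg_iff] at hy
  have : y < c := hyc
  rcases hy with hy | hy <;> linarith [hy.1, hy.2]

/-- The second derivative is nonnegative at a minimum approached from the right. -/
lemma nonneg_of_min_right {x v : ℝ → ℝ} {d a b : ℝ} (hab : a < b)
    (hx : ∀ y ∈ Icc a b, HasDerivAt x (v y) y) (hv : HasDerivAt v d a) (hva : v a = 0)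
    (hmin : ∀ y ∈ Icc a b, x a ≤ x y) : 0 ≤ d := by
  by_contra! hd
  obtain ⟨c, hc, hcI⟩ := (mem_nhdsGT_iff_exists_Ioc_subset).1 (eventually_lt_right hv hd)
  set e := min b c
  have hae : a < e := lt_min hab hc
  have := lt_of_hasDerivAt_pos (f := fun y => - x y) (f' := fun y => - v y) hae
    (fun y hy => (hx y ⟨hy.1, hy.2.trans (min_le_left _ _)⟩).neg)
    (fun y hy => by
      have : v y < v a := hcI ⟨hy.1, hy.2.le.trans (min_le_right _ _)⟩
      linarith)
  linarith [hmin e ⟨hae.le, min_le_left _ _⟩]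

lemma nonpos_of_max_right {x v : ℝ → ℝ} {d a b : ℝ} (hab : a < b)
    (hx : ∀ y ∈ Icc a b, HasDerivAt x (v y) y) (hv : HasDerivAt v d a) (hva : v a = 0)
    (hmax : ∀ y ∈ Icc a b, x y ≤ x a) : d ≤ 0 := by
  have := nonneg_of_min_right (x := fun y => - x y) (v := fun y => - v y) (d := -d) hab
    (fun y hy => (hx y hy).neg) hv.neg (by simp [hva]) (fun y hy => neg_le_neg (hmax y hy))
  linarith

/-- If `h` cannot increase while positive, it stays below any nonnegative level. -/
lemma le_of_deriv_nonpos_of_pos {h h' : ℝ → ℝ} {a b M : ℝ} (hab : a ≤ b)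
    (hh : ∀ y ∈ Icc a b, HasDerivAt h (h' y) y) (hp : ∀ y ∈ Icc a b, 0 < h y → h' y ≤ 0)
    (hM : 0 ≤ M) (ha : h a ≤ M) : h b ≤ M := by
  by_contra! hb
  have hcont : ContinuousOn h (Icc a b) :=
    fun y hy => (hh y hy).continuousAt.continuousWithinAt
  have hcl : IsClosed (Icc a b ∩ h ⁻¹' Iic M) := hcont.preimage_isClosed_of_isClosed isClosed_Icc
    isClosed_Iic
  have hne : (Icc a b ∩ h ⁻¹' Iic M).Nonempty := ⟨a, ⟨le_rfl, hab⟩, ha⟩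
  have hbd : BddAbove (Icc a b ∩ h ⁻¹' Iic M) := ⟨b, fun y hy => hy.1.2⟩
  set c := sSup (Icc a b ∩ h ⁻¹' Iic M)
  have hc : c ∈ Icc a b ∩ h ⁻¹' Iic M := hcl.csSup_mem hne hbd
  have : h b ≤ h c := ge_of_hasDerivAt_nonpos hc.1.2
    (fun y hy => hh y ⟨hc.1.1.trans hy.1, hy.2⟩) (fun y hy => by
      have hy' : y ∈ Icc a b := ⟨hc.1.1.trans hy.1.le, hy.2.le⟩
      refine hp y hy' ?_
      by_contra! h0
      exact absurd (le_csSup hbd ⟨hy', h0.trans hM⟩) (not_le.2 hy.1))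
  have h2 : h c ≤ M := hc.2
  linarith

/-! ### Growth of solutions of linear equations -/

lemma linear_energy_le {w p q : ℝ → ℝ} {a b Q : ℝ} (hab : a ≤ b)
    (hw : ∀ y ∈ Icc a b, HasDerivAt w (p y) y)
    (hp : ∀ y ∈ Icc a b, HasDerivAt p (q y * w y) y)
    (hq : ∀ y ∈ Icc a b, |q y| ≤ Q) :
    (w b ^ 2 + p b ^ 2 ≤ (w a ^ 2 + p a ^ 2) * exp ((1 + Q) * (b - a))) ∧
    (w a ^ 2 + p a ^ 2 ≤ (w b ^ 2 + p b ^ 2) * exp ((1 + Q) * (b - a))) := by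
  have he : ∀ y ∈ Icc a b, HasDerivAt (fun y => w y ^ 2 + p y ^ 2)
      (2 * (1 + q y) * (w y * p y)) y := by
    intro y hy
    refine (((hw y hy).pow 2).add ((hp y hy).pow 2)).congr_deriv ?_
    simp; ring
  have hb : ∀ y ∈ Icc a b, |2 * (1 + q y) * (w y * p y)| ≤ (1 + Q) * (w y ^ 2 + p y ^ 2) := by
    intro y hy
    have h1 : |1 + q y| ≤ 1 + Q := (abs_add_le _ _).trans (by simpa using hq y hy)
    have h2 : |2 * (w y * p y)| ≤ w y ^ 2 + p y ^ 2 := abs_le.2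
      ⟨by nlinarith [sq_nonneg (w y + p y)], by nlinarith [sq_nonneg (w y - p y)]⟩
    calc |2 * (1 + q y) * (w y * p y)| = |1 + q y| * |2 * (w y * p y)| := by
          rw [← abs_mul]; congr 1; ring
      _ ≤ _ := mul_le_mul h1 h2 (abs_nonneg _) ((abs_nonneg _).trans h1)
  have hexp : ∀ k y : ℝ, HasDerivAt (fun y => exp (k * (y - a))) (k * exp (k * (y - a))) y := by
    intro k y
    have := (((hasDerivAt_id y).sub_const a).const_mul k).exp
    simpa [mul_comm] using this
  constructor
  · have := ge_of_hasDerivAt_nonpos hab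
      (fun y hy => (he y hy).mul (hexp (-(1 + Q)) y)) (fun y hy => by
        have h1 := (abs_le.1 (hb y (Ioo_subset_Icc_self hy))).2
        have h2 := exp_pos (-(1 + Q) * (y - a))
        nlinarith)
    simp only [Pi.mul_apply, sub_self, mul_zero, exp_zero, mul_one] at this
    rw [neg_mul, exp_neg, ← div_eq_mul_inv, div_le_iff₀ (exp_pos _)] at this
    exact this
  · have := le_of_hasDerivAt_nonneg hab
      (fun y hy => (he y hy).mul (hexp (1 + Q) y)) (fun y hy => by
        have h1 := (abs_le.1 (hb y (Ioo_subset_Icc_self hy))).1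
        have h2 := exp_pos ((1 + Q) * (y - a))
        nlinarith)
    simpa using this

lemma linear_eq_zero {w p q : ℝ → ℝ} {a b c : ℝ} (hc : c ∈ Icc a b)
    (hw : ∀ y ∈ Icc a b, HasDerivAt w (p y) y)
    (hp : ∀ y ∈ Icc a b, HasDerivAt p (q y * w y) y)
    (hq : ContinuousOn q (Icc a b)) (hwc : w c = 0) (hpc : p c = 0) :
    ∀ y ∈ Icc a b, w y = 0 := by
  obtain ⟨Q, hQ⟩ := isCompact_Icc.exists_bound_of_continuousOn hq
  intro y hy
  rcases le_total c y with h | h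
  · have hs : Icc c y ⊆ Icc a b := Icc_subset_Icc hc.1 hy.2
    have := (linear_energy_le h (fun z hz => hw z (hs hz)) (fun z hz => hp z (hs hz))
      (fun z hz => hQ z (hs hz))).1
    rw [hwc, hpc] at this
    nlinarith [sq_nonneg (w y), sq_nonneg (p y)]
  · have hs : Icc y c ⊆ Icc a b := Icc_subset_Icc hy.1 hc.2
    have := (linear_energy_le h (fun z hz => hw z (hs hz)) (fun z hz => hp z (hs hz))
      (fun z hz => hQ z (hs hz))).2
    rw [hwc, hpc] at this
    nlinarith [sq_nonneg (w y), sq_nonneg (p y)]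

/-! ### Shooting for a bounded nonlinearity -/

lemma exists_shooting_family {F : ℝ → ℝ → ℝ} {K : ℝ≥0} {C N S : ℝ} (hN : 0 < N) (hS : 0 ≤ S)
    (hF : ∀ t ∈ Icc (-N - 1) (N + 1), LipschitzWith K (F t)) (hFc : ∀ x, Continuous fun t => F t x)
    (hC : ∀ t ∈ Icc (-N - 1) (N + 1), ∀ x, |F t x| ≤ C) :
    ∃ x v : ℝ → ℝ → ℝ, (∀ s ∈ Icc 0 S, x s (-N) = 0 ∧ v s (-N) = s ∧
      ∀ t ∈ Icc (-N) N, HasDerivAt (x s) (v s t) t ∧ HasDerivAt (v s) (F t (x s t)) t) ∧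
      ContinuousOn (fun s => x s N) (Icc 0 S) := by
  have hC0 : 0 ≤ C := (abs_nonneg _).trans (hC 0 ⟨by linarith, by linarith⟩ 0)
  set V : ℝ := S + C * (2 * N + 2)
  have hV : 0 ≤ V := by positivity
  set G : ℝ → ℝ × ℝ → ℝ × ℝ := fun t z => (max (-V) (min z.2 V), F t z.1) with hG
  set L : ℝ := max V C
  have hL : 0 ≤ L := le_max_of_le_left hV
  set M : ℝ := S + L * (2 * N + 2)
  have hM : 0 ≤ M := by positivity
  have hmem : -N ∈ Icc (-N - 1) (N + 1) := ⟨by linarith, by linarith⟩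
  have hclip : LipschitzWith 1 (fun r : ℝ => max (-V) (min r V)) :=
    (LipschitzWith.id.min_const V).const_max (-V)
  have hPL : IsPicardLindelof G (⟨-N, hmem⟩ : Icc (-N - 1) (N + 1)) (0 : ℝ × ℝ)
      ⟨M, hM⟩ ⟨S, hS⟩ ⟨L, hL⟩ (max 1 K) := by
    refine ⟨fun t ht => ?_, fun z _ => ?_, fun t ht z _ => ?_, ?_⟩
    · refine LipschitzWith.lipschitzOnWith ?_
      have h1 : LipschitzWith 1 (fun z : ℝ × ℝ => max (-V) (min z.2 V)) := by
        simpa [Function.comp_def] using hclip.comp LipschitzWith.prod_snd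
      have h2 : LipschitzWith K (fun z : ℝ × ℝ => F t z.1) := by
        simpa [Function.comp_def] using (hF t ht).comp LipschitzWith.prod_fst
      exact h1.prodMk h2
    · exact (continuous_const.prodMk (hFc z.1)).continuousOn
    · refine (Prod.norm_def _).trans_le (max_le_max ?_ (hC t ht z.1))
      exact abs_le.2 ⟨le_max_left _ _, max_le (by linarith) (min_le_right _ _)⟩
    · change L * max (N + 1 - -N) (-N - (-N - 1)) ≤ M - S
      have : max (N + 1 - -N) (-N - (-N - 1)) ≤ 2 * N + 2 := max_le (by linarith) (by linarith)
      have := mul_le_mul_of_nonneg_left this hL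
      simp only [M]; linarith
  obtain ⟨α, hα, L', hL'⟩ :=
    hPL.exists_forall_mem_closedBall_eq_hasDerivWithinAt_lipschitzOnWith
  have hball : ∀ s ∈ Icc 0 S, ((0 : ℝ), s) ∈ Metric.closedBall (0 : ℝ × ℝ) S := by
    intro s hs
    simp [Prod.norm_def, abs_of_nonneg hs.1, hs.2, hS]
  refine ⟨fun s t => (α (0, s) t).1, fun s t => (α (0, s) t).2, fun s hs => ?_, ?_⟩
  · obtain ⟨h0, hd⟩ := hα (0, s) (hball s hs)
    have h0' : α (0, s) (-N) = (0, s) := h0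
    have hd1 : ∀ t ∈ Icc (-N) N, HasDerivAt (α (0, s)) (G t (α (0, s) t)) t := fun t ht =>
      (hd t ⟨by linarith [ht.1], by linarith [ht.2]⟩).hasDerivAt
        (Icc_mem_nhds (by linarith [ht.1]) (by linarith [ht.2]))
    have hfst : ∀ t ∈ Icc (-N) N, HasDerivAt (fun t => (α (0, s) t).1)
        (max (-V) (min (α (0, s) t).2 V)) t := fun t ht => (hd1 t ht).fst
    have hsnd : ∀ t ∈ Icc (-N) N, HasDerivAt (fun t => (α (0, s) t).2)
        (F t (α (0, s) t).1) t := fun t ht => (hd1 t ht).snd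
    refine ⟨by simp [h0'], by simp [h0'], fun t ht => ⟨?_, hsnd t ht⟩⟩
    have hCb : ∀ y ∈ Icc (-N) N, |F y (α (0, s) y).1| ≤ C :=
      fun y hy => hC y ⟨by linarith [hy.1], by linarith [hy.2]⟩ _
    have hsub : Icc (-N) t ⊆ Icc (-N) N := Icc_subset_Icc_right ht.2
    have hle := le_add_mul_sub ht.1 (fun y hy => hsnd y (hsub hy))
      (fun y hy => (abs_le.1 (hCb y (hsub (Ioo_subset_Icc_self hy)))).2)
    have hge := add_mul_sub_le ht.1 (fun y hy => hsnd y (hsub hy))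
      (fun y hy => (abs_le.1 (hCb y (hsub (Ioo_subset_Icc_self hy)))).1)
    have hlen : C * (t - -N) ≤ C * (2 * N + 2) :=
      mul_le_mul_of_nonneg_left (by linarith [ht.2]) hC0
    simp only [h0'] at hle hge
    have h1 : (α (0, s) t).2 ≤ V := by simp only [V]; linarith [hs.2]
    have h2 : -V ≤ (α (0, s) t).2 := by simp only [V]; linarith [hs.1]
    have := hfst t ht
    rwa [min_eq_left h1, max_eq_right h2] at this
  · have hc := (hL' N ⟨by linarith, by linarith⟩).continuousOn
    exact continuous_fst.comp_continuousOn
      (hc.comp (continuous_const.prodMk continuous_id).continuousOn hball)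

/-! ### The boundary value problem on a symmetric interval -/

/-- The pair `(x, v)` solves `x' = v`, `v' = x (x² - y) / 4` on `s`. -/
structure IsSolOn (x v : ℝ → ℝ) (s : Set ℝ) : Prop where
  hx : ∀ y ∈ s, HasDerivAt x (v y) y
  hv : ∀ y ∈ s, HasDerivAt v (x y * (x y ^ 2 - y) / 4) y

lemma IsSolOn.mono {x v : ℝ → ℝ} {s t : Set ℝ} (h : IsSolOn x v s) (hts : t ⊆ s) :
    IsSolOn x v t :=
  ⟨fun y hy => h.hx y (hts hy), fun y hy => h.hv y (hts hy)⟩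

lemma exists_truncation {N : ℝ} (hN : 1 ≤ N) :
    ∃ F : ℝ → ℝ → ℝ, ∃ K : ℝ≥0, ∃ C : ℝ,
      (∀ t ∈ Icc (-N - 1) (N + 1), LipschitzWith K (F t)) ∧
      (∀ x, Continuous fun t => F t x) ∧
      (∀ t ∈ Icc (-N - 1) (N + 1), ∀ x, |F t x| ≤ C) ∧
      (∀ t, F t 0 = 0) ∧
      (∀ t x, x < 0 → F t x < 0) ∧
      (∀ t x, t < N → √N < x → 0 < F t x) ∧
      (∀ t x, 0 ≤ x → x ≤ √N → F t x = x * (x ^ 2 - t) / 4) := by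
  set R := √N with hR
  have hR2 : R ^ 2 = N := Real.sq_sqrt (by linarith)
  have hR1 : 1 ≤ R := Real.one_le_sqrt.2 hN
  set c : ℝ → ℝ := fun x => max 0 (min x R) with hc
  set d : ℝ → ℝ := fun x => max (-1) (min x 0) with hd
  have hcL : LipschitzWith 1 c := (LipschitzWith.id.min_const R).const_max 0
  have hdL : LipschitzWith 1 d := (LipschitzWith.id.min_const 0).const_max (-1)
  have hc0 : ∀ x, 0 ≤ c x := fun x => le_max_left _ _
  have hcR : ∀ x, c x ≤ R := fun x => max_le (by linarith) (min_le_right _ _)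
  have hd1 : ∀ x, -1 ≤ d x := fun x => le_max_left _ _
  have hd0 : ∀ x, d x ≤ 0 := fun x => max_le (by linarith) (min_le_right _ _)
  have hcpos : ∀ x, 0 ≤ x → x ≤ R → c x = x := fun x h0 h1 => by simp [hc, h0, h1]
  have hdpos : ∀ x, 0 ≤ x → d x = 0 := fun x h0 => by simp [hd, h0]
  refine ⟨fun t x => c x * (c x ^ 2 - t) / 4 + d x, ⟨N + 2, by linarith⟩, R * (2 * N + 1) / 4 + 1,
    fun t ht => ?_, fun x => by fun_prop, fun t ht x => ?_, fun t => ?_, fun t x hx => ?_,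
    fun t x ht hx => ?_, fun t x h0 h1 => ?_⟩
  · refine LipschitzWith.of_dist_le_mul fun x y => ?_
    have h1 := hcL.dist_le_mul x y
    have h2 := hdL.dist_le_mul x y
    simp only [NNReal.coe_one, one_mul, Real.dist_eq] at h1 h2
    change |c x * (c x ^ 2 - t) / 4 + d x - (c y * (c y ^ 2 - t) / 4 + d y)| ≤ (N + 2) * |x - y|
    have e : c x * (c x ^ 2 - t) / 4 + d x - (c y * (c y ^ 2 - t) / 4 + d y) =
      (c x ^ 2 + c x * c y + c y ^ 2 - t) / 4 * (c x - c y) + (d x - d y) := by ring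
    have hb : |(c x ^ 2 + c x * c y + c y ^ 2 - t) / 4| ≤ N + 1 := by
      have a1 := mul_le_mul (hcR x) (hcR x) (hc0 x) (by linarith)
      have a2 := mul_le_mul (hcR x) (hcR y) (hc0 y) (by linarith)
      have a3 := mul_le_mul (hcR y) (hcR y) (hc0 y) (by linarith)
      have a4 := mul_nonneg (hc0 x) (hc0 y)
      rw [abs_le]
      constructor <;> nlinarith [ht.1, ht.2, sq_nonneg (c x), sq_nonneg (c y)]
    rw [e]
    calc _ ≤ |(c x ^ 2 + c x * c y + c y ^ 2 - t) / 4| * |c x - c y| + |d x - d y| := by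
          rw [← abs_mul]; exact abs_add_le _ _
      _ ≤ (N + 1) * |x - y| + |x - y| :=
          add_le_add (mul_le_mul hb h1 (abs_nonneg _) (by linarith)) h2
      _ = _ := by ring
  · have hb : |c x * (c x ^ 2 - t) / 4| ≤ R * (2 * N + 1) / 4 := by
      have h1 : |c x ^ 2 - t| ≤ 2 * N + 1 := by
        have := mul_le_mul (hcR x) (hcR x) (hc0 x) (by linarith)
        rw [abs_le]
        constructor <;> nlinarith [ht.1, ht.2, sq_nonneg (c x)]
      rw [abs_div, abs_mul, abs_of_nonneg (hc0 x), abs_of_pos (by norm_num : (0 : ℝ) < 4)]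
      exact div_le_div_of_nonneg_right (mul_le_mul (hcR x) h1 (abs_nonneg _) (by linarith))
        (by norm_num)
    exact (abs_add_le _ _).trans (add_le_add hb (abs_le.2 ⟨hd1 x, by linarith [hd0 x]⟩))
  · simp [hcpos 0 le_rfl (by linarith), hdpos 0 le_rfl]
  · have h1 : c x = 0 := max_eq_left ((min_le_left _ _).trans hx.le)
    have h2 : d x < 0 := max_lt (by norm_num) ((min_le_left _ _).trans_lt hx)
    simpa [h1] using h2
  · have h1 : c x = R := by
      simp only [hc]; rw [min_eq_right hx.le, max_eq_right (by linarith)]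
    change 0 < c x * (c x ^ 2 - t) / 4 + d x
    rw [h1, hdpos x (by linarith), hR2]
    have := mul_pos (show 0 < R by linarith) (sub_pos.2 ht)
    linarith
  · change c x * (c x ^ 2 - t) / 4 + d x = _
    rw [hcpos x h0 h1, hdpos x h0, add_zero]

lemma exists_boundary_value {N : ℝ} (hN : 1 ≤ N) :
    ∃ x v : ℝ → ℝ, IsSolOn x v (Icc (-N) N) ∧ x (-N) = 0 ∧ x N = √N ∧
      ∀ y ∈ Icc (-N) N, 0 ≤ x y := by
  obtain ⟨F, K, C, hLip, hcont, hC, hF0, hFneg, hFbig, hF⟩ := exists_truncation hN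
  have hR1 : 1 ≤ √N := Real.one_le_sqrt.2 hN
  have hC0 : 0 ≤ C := (abs_nonneg _).trans (hC 0 ⟨by linarith, by linarith⟩ 0)
  have hN' : -N ≤ N := by linarith
  set S : ℝ := C * (2 * N) + √N
  have hS : 0 ≤ S := by positivity
  obtain ⟨x, v, hxv, hxc⟩ := exists_shooting_family (by linarith) hS hLip hcont hC
  have hsub : Icc (-N) N ⊆ Icc (-N - 1) (N + 1) := Icc_subset_Icc (by linarith) (by linarith)
  have hzero : x 0 N ≤ √N := by
    obtain ⟨h0, h1, hd⟩ := hxv 0 ⟨le_rfl, hS⟩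
    have := (linear_energy_le (q := fun t => F t (x 0 t) / x 0 t) (Q := K) hN'
      (fun y hy => (hd y hy).1) (fun y hy => by
        refine (hd y hy).2.congr_deriv ?_
        by_cases hz : x 0 y = 0
        · simp [hz, hF0]
        · field_simp) (fun y hy => by
        have := (hLip y (hsub hy)).dist_le_mul (x 0 y) 0
        rw [hF0, Real.dist_eq, Real.dist_eq, sub_zero, sub_zero] at this
        rw [abs_div]
        exact div_le_of_le_mul₀ (abs_nonneg _) K.2 this)).1
    rw [h0, h1] at this
    have h2 : x 0 N = 0 := by nlinarith [sq_nonneg (x 0 N), sq_nonneg (v 0 N)]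
    linarith
  have hlarge : √N ≤ x S N := by
    obtain ⟨h0, h1, hd⟩ := hxv S ⟨hS, le_rfl⟩
    have hv : ∀ y ∈ Icc (-N) N, √N ≤ v S y := by
      intro y hy
      have hs : Icc (-N) y ⊆ Icc (-N) N := Icc_subset_Icc_right hy.2
      have := add_mul_sub_le hy.1 (fun z hz => (hd z (hs hz)).2)
        (fun z hz => (abs_le.1 (hC z (hsub (hs (Ioo_subset_Icc_self hz))) _)).1)
      have h2 : C * (y - -N) ≤ C * (2 * N) := mul_le_mul_of_nonneg_left (by linarith [hy.2]) hC0
      rw [h1] at this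
      simp only [S] at this ⊢
      linarith
    have := add_mul_sub_le hN' (fun z hz => (hd z hz).1)
      (fun z hz => hv z (Ioo_subset_Icc_self hz))
    rw [h0] at this
    nlinarith
  obtain ⟨s, hs, hsN⟩ := intermediate_value_Icc hS hxc ⟨hzero, hlarge⟩
  obtain ⟨h0, -, hd⟩ := hxv s hs
  have hsN : x s N = √N := hsN
  have hxcont : ContinuousOn (x s) (Icc (-N) N) :=
    fun y hy => (hd y hy).1.continuousAt.continuousWithinAt
  have hnonneg : ∀ y ∈ Icc (-N) N, 0 ≤ x s y := by
    obtain ⟨z, hz, hmin⟩ := isCompact_Icc.exists_isMinOn (nonempty_Icc.2 hN') hxcont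
    have hmin' : ∀ y ∈ Icc (-N) N, x s z ≤ x s y := fun y hy => hmin hy
    by_contra! ⟨y, hy, hneg⟩
    have hzneg : x s z < 0 := (hmin' y hy).trans_lt hneg
    have hz1 : -N < z := lt_of_le_of_ne hz.1 (by rintro rfl; linarith)
    have hz2 : z < N := lt_of_le_of_ne hz.2 (by rintro rfl; linarith)
    have hv0 : v s z = 0 :=
      (hmin.isLocalMin (Icc_mem_nhds hz1 hz2)).hasDerivAt_eq_zero (hd z hz).1
    have := nonneg_of_min_right hz2 (fun y hy => (hd y ⟨hz.1.trans hy.1, hy.2⟩).1) (hd z hz).2 hv0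
      (fun y hy => hmin' y ⟨hz.1.trans hy.1, hy.2⟩)
    linarith [hFneg z _ hzneg]
  have hle : ∀ y ∈ Icc (-N) N, x s y ≤ √N := by
    obtain ⟨z, hz, hmax⟩ := isCompact_Icc.exists_isMaxOn (nonempty_Icc.2 hN') hxcont
    have hmax' : ∀ y ∈ Icc (-N) N, x s y ≤ x s z := fun y hy => hmax hy
    by_contra! ⟨y, hy, hgt⟩
    have hzgt : √N < x s z := hgt.trans_le (hmax' y hy)
    have hz1 : -N < z := lt_of_le_of_ne hz.1 (by rintro rfl; linarith)
    have hz2 : z < N := lt_of_le_of_ne hz.2 (by rintro rfl; linarith)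
    have hv0 : v s z = 0 :=
      (hmax.isLocalMax (Icc_mem_nhds hz1 hz2)).hasDerivAt_eq_zero (hd z hz).1
    have := nonpos_of_max_right hz2 (fun y hy => (hd y ⟨hz.1.trans hy.1, hy.2⟩).1) (hd z hz).2 hv0
      (fun y hy => hmax' y ⟨hz.1.trans hy.1, hy.2⟩)
    linarith [hFbig z _ hz2 hzgt]
  refine ⟨x s, v s, ⟨fun y hy => (hd y hy).1, fun y hy => ?_⟩, h0, hsN, hnonneg⟩
  exact (hd y hy).2.congr_deriv (hF y _ (hnonneg y hy) (hle y hy))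

/-! ### Structure of solutions -/

namespace IsSolOn

variable {x v : ℝ → ℝ} {s : Set ℝ} {a b y N : ℝ}

lemma hasDerivAt_gap (h : IsSolOn x v s) (hy : y ∈ s) :
    HasDerivAt (fun y => x y ^ 2 - y) (2 * x y * v y - 1) y := by
  refine (((h.hx y hy).pow 2).sub (hasDerivAt_id y)).congr_deriv ?_
  simp

lemma hasDerivAt_gap_deriv (h : IsSolOn x v s) (hy : y ∈ s) :
    HasDerivAt (fun y => 2 * x y * v y - 1) (2 * v y ^ 2 + x y ^ 2 * (x y ^ 2 - y) / 2) y := by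
  refine ((((h.hx y hy).const_mul 2).mul (h.hv y hy)).sub_const 1).congr_deriv ?_
  ring

lemma hasDerivAt_energy (h : IsSolOn x v s) (hy : y ∈ s) :
    HasDerivAt (fun y => 2 * v y ^ 2 + y * x y ^ 2 / 2 - x y ^ 4 / 4) (x y ^ 2 / 2) y := by
  refine (((((h.hv y hy).pow 2).const_mul 2).add
    (((hasDerivAt_id y).mul ((h.hx y hy).pow 2)).div_const 2)).sub
    (((h.hx y hy).pow 4).div_const 4)).congr_deriv ?_
  simp; ring

lemma hasDerivAt_gap_energy (h : IsSolOn x v s) (hy : y ∈ s) :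
    HasDerivAt (fun y => (x y ^ 2 - y) ^ 2 / 4 - 2 * v y ^ 2) (-(x y ^ 2 - y) / 2) y := by
  refine ((((h.hasDerivAt_gap hy).pow 2).div_const 4).sub
    (((h.hv y hy).pow 2).const_mul 2)).congr_deriv ?_
  simp; ring

lemma continuousOn_fst (h : IsSolOn x v s) : ContinuousOn x s :=
  fun y hy => (h.hx y hy).continuousAt.continuousWithinAt

lemma continuousOn_snd (h : IsSolOn x v s) : ContinuousOn v s :=
  fun y hy => (h.hv y hy).continuousAt.continuousWithinAt

lemma eq_zero (h : IsSolOn x v (Icc a b)) (hy : y ∈ Icc a b) (hx0 : x y = 0) (hv0 : v y = 0) :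
    ∀ z ∈ Icc a b, x z = 0 :=
  linear_eq_zero (q := fun y => (x y ^ 2 - y) / 4) hy h.hx
    (fun z hz => (h.hv z hz).congr_deriv (by ring))
    (((h.continuousOn_fst.pow 2).sub continuousOn_id).div_const 4) hx0 hv0

lemma pos_of_boundary (h : IsSolOn x v (Icc (-N) N)) (hN : 1 ≤ N) (hl : x (-N) = 0)
    (hr : x N = √N) (hx : ∀ y ∈ Icc (-N) N, 0 ≤ x y) :
    (∀ y ∈ Ioc (-N) N, 0 < x y) ∧ 0 < v (-N) := by
  have hR : 1 ≤ √N := Real.one_le_sqrt.2 hN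
  have hmem : N ∈ Icc (-N) N := ⟨by linarith, le_rfl⟩
  have hmem' : -N ∈ Icc (-N) N := ⟨le_rfl, by linarith⟩
  have key : ∀ y ∈ Icc (-N) N, x y = 0 → v y ≠ 0 := fun y hy h0 h1 => by
    linarith [h.eq_zero hy h0 h1 N hmem]
  constructor
  · intro y hy
    have hy' := Ioc_subset_Icc_self hy
    refine lt_of_le_of_ne (hx y hy') fun h0 => key y hy' h0.symm ?_
    have hyN : y < N := lt_of_le_of_ne hy.2 (by rintro rfl; linarith)
    have hmin : IsLocalMin x y := by
      filter_upwards [Icc_mem_nhds hy.1 hyN] with z hz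
      rw [← h0]; exact hx z hz
    exact hmin.hasDerivAt_eq_zero (h.hx y hy')
  · by_contra! hv
    rcases hv.lt_or_eq with hv | hv
    · obtain ⟨c, hc, hcI⟩ := mem_nhdsGT_iff_exists_Ioc_subset.1
        (eventually_lt_right (h.hx _ hmem') hv)
      have hc' : -N < min c N := lt_min hc (by linarith)
      have h1 : x (min c N) < x (-N) := hcI ⟨hc', min_le_left _ _⟩
      linarith [hx (min c N) ⟨hc'.le, min_le_right _ _⟩]
    · exact key _ hmem' hl hv

lemma deriv_pos_of_boundary (h : IsSolOn x v (Icc (-N) N)) (hN : 1 ≤ N) (hl : x (-N) = 0)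
    (hr : x N = √N) (hx : ∀ y ∈ Icc (-N) N, 0 ≤ x y) : ∀ y ∈ Icc (-N) N, 0 < v y := by
  obtain ⟨hpos, hv0⟩ := h.pos_of_boundary hN hl hr hx
  by_contra! ⟨y, hy, hvy⟩
  obtain ⟨c, hc, hvc, hlt⟩ := exists_first_zero (f := fun y => - v y) hy.1
    (h.continuousOn_snd.neg.mono (Icc_subset_Icc_right hy.2)) (by simpa using hv0)
    (by simpa using hvy)
  have hvc : v c = 0 := by simpa using hvc
  have hlt : ∀ z ∈ Ico (-N) c, 0 < v z := fun z hz => by simpa using hlt z hz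
  have hcI : c ∈ Icc (-N) N := ⟨hc.1.le, hc.2.trans hy.2⟩
  have hgap : x c ^ 2 - c < 0 := by
    by_contra! hge
    have hev : ∀ᶠ z in 𝓝[<] c, 0 < x z ^ 2 - z := by
      rcases hge.lt_or_eq with hge | hge
      · exact ((h.hasDerivAt_gap hcI).continuousAt.eventually_const_lt hge).filter_mono
          nhdsWithin_le_nhds
      · have := eventually_gt_left (h.hasDerivAt_gap hcI) (by rw [hvc]; norm_num)
        filter_upwards [this] with z hz
        linarith
    obtain ⟨e, he, heI⟩ := mem_nhdsLT_iff_exists_Ioo_subset.1 hev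
    have he : e < c := he
    set e' := max e (-N)
    have he' : e' < c := max_lt he hc.1
    have := lt_of_hasDerivAt_pos he'
      (fun z hz => h.hv z ⟨(le_max_right _ _).trans hz.1, hz.2.trans hcI.2⟩) (fun z hz => by
        have h1 : 0 < x z ^ 2 - z := heI ⟨(le_max_left _ _).trans_lt hz.1, hz.2⟩
        have h2 := hpos z ⟨(le_max_right _ _).trans_lt hz.1, hz.2.le.trans hcI.2⟩
        positivity)
    linarith [hlt e' ⟨le_max_right _ _, he'⟩]
  have hgapN : 0 ≤ x N ^ 2 - N := by rw [hr, Real.sq_sqrt (by linarith)]; simp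
  have hsub : Icc c N ⊆ Icc (-N) N := Icc_subset_Icc_left hcI.1
  obtain ⟨d, hd, hgd, hdlt⟩ := exists_first_zero (f := fun y => x y ^ 2 - y) hcI.2
    (fun z hz => (h.hasDerivAt_gap (hsub hz)).continuousAt.continuousWithinAt) hgap hgapN
  have := le_of_hasDerivAt_nonneg hd.1.le
    (fun z hz => h.hasDerivAt_gap_energy (hsub ⟨hz.1, hz.2.trans hd.2⟩)) (fun z hz => by
      linarith [hdlt z (Ioo_subset_Ico_self hz)])
  rw [hgd, hvc] at this
  nlinarith [sq_nonneg (v d)]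

lemma gap_deriv_nonpos_of_boundary (h : IsSolOn x v (Icc (-N) N)) (hN : 1 ≤ N)
    (hr : x N = √N) : ∀ y ∈ Icc (-N) N, 0 < x y ^ 2 - y → 2 * x y * v y - 1 ≤ 0 := by
  intro y hy hgap
  by_contra! hd
  have hsub : Icc y N ⊆ Icc (-N) N := Icc_subset_Icc_left hy.1
  obtain ⟨c, hc, hc0, hlt⟩ := exists_first_zero (f := fun y => -(x y ^ 2 - y)) hy.2
    (fun z hz => (h.hasDerivAt_gap (hsub hz)).neg.continuousAt.continuousWithinAt)
    (by linarith) (by rw [hr, Real.sq_sqrt (by linarith)]; simp)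
  have hsub' : Icc y c ⊆ Icc (-N) N := (Icc_subset_Icc_right hc.2).trans hsub
  have hder : ∀ z ∈ Icc y c, 2 * x y * v y - 1 ≤ 2 * x z * v z - 1 := by
    intro z hz
    refine le_of_hasDerivAt_nonneg hz.1
      (fun t ht => h.hasDerivAt_gap_deriv (hsub' ⟨ht.1, ht.2.trans hz.2⟩)) (fun t ht => ?_)
    have : 0 < x t ^ 2 - t := by linarith [hlt t ⟨ht.1.le, ht.2.trans_le hz.2⟩]
    positivity
  have := le_of_hasDerivAt_nonneg hc.1.le (fun z hz => h.hasDerivAt_gap (hsub' hz))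
    (fun z hz => by linarith [hder z (Ioo_subset_Icc_self hz)])
  linarith

end IsSolOn

lemma exists_monotone_solution_Icc {N : ℝ} (hN : 10 ≤ N) :
    ∃ x v : ℝ → ℝ, IsSolOn x v (Icc (-N) N) ∧
      (∀ y ∈ Icc (-N) N, 0 ≤ x y ∧ 0 ≤ v y ∧ (0 < x y ^ 2 - y → 2 * x y * v y - 1 ≤ 0) ∧
        x y ≤ |y| + 2) ∧ v 0 ≤ 5 ∧ 1 ≤ x 10 := by
  have hN1 : 1 ≤ N := by linarith
  obtain ⟨x, v, h, hl, hr, hx⟩ := exists_boundary_value hN1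
  obtain ⟨hpos, -⟩ := h.pos_of_boundary hN1 hl hr hx
  have hv := h.deriv_pos_of_boundary hN1 hl hr hx
  have hgap := h.gap_deriv_nonpos_of_boundary hN1 hr
  have hmono : ∀ y ∈ Icc (-N) N, ∀ z ∈ Icc (-N) N, y ≤ z → x y ≤ x z := fun y hy z hz hyz =>
    le_of_hasDerivAt_nonneg hyz (fun t ht => h.hx t ⟨hy.1.trans ht.1, ht.2.trans hz.2⟩)
      (fun t ht => (hv t ⟨hy.1.trans ht.1.le, ht.2.le.trans hz.2⟩).le)
  have m0 : (0 : ℝ) ∈ Icc (-N) N := ⟨by linarith, by linarith⟩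
  have m1 : (-1 : ℝ) ∈ Icc (-N) N := ⟨by linarith, by linarith⟩
  have ha : 0 < x 0 := hpos 0 ⟨by linarith, m0.2⟩
  have hv0 := hv 0 m0
  have ha2 : x 0 ≤ 2 := by
    have hE := le_of_hasDerivAt_nonneg m0.1
      (fun t ht => h.hasDerivAt_energy ⟨ht.1, ht.2.trans m0.2⟩) (fun t _ => by positivity)
    rw [hl] at hE
    have hg := hgap 0 m0 (by nlinarith)
    have h1 : x 0 ^ 4 ≤ 8 * v 0 ^ 2 := by nlinarith [sq_nonneg (v (-N))]
    have h2 : (2 * x 0 * v 0) ^ 2 ≤ 1 := by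
      have : 0 < 2 * x 0 * v 0 := by positivity
      nlinarith
    have h3 : x 0 ^ 6 ≤ 2 := by
      nlinarith [mul_le_mul_of_nonneg_left h1 (sq_nonneg (x 0))]
    by_contra! h4
    have : (2 : ℝ) ^ 6 < x 0 ^ 6 := pow_lt_pow_left₀ h4 (by norm_num) (by norm_num)
    norm_num at this
    linarith
  have hb : v 0 ≤ 5 := by
    have hsub : Icc (-1 : ℝ) 0 ⊆ Icc (-N) N := Icc_subset_Icc m1.1 m0.2
    have hvb : ∀ y ∈ Icc (-1 : ℝ) 0, v 0 - 5 / 2 ≤ v y := by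
      intro y hy
      have := le_add_mul_sub (m := 5 / 2) hy.2 (fun t ht => h.hv t (hsub ⟨hy.1.trans ht.1, ht.2⟩))
        (fun t ht => by
          have htI : t ∈ Icc (-1 : ℝ) 0 := ⟨hy.1.trans ht.1.le, ht.2.le⟩
          have h1 := hx t (hsub htI)
          have h2 : x t ≤ 2 := (hmono t (hsub htI) 0 m0 htI.2).trans ha2
          have h3 : x t ^ 2 - t ≤ 5 := by nlinarith [htI.1]
          nlinarith [mul_le_mul_of_nonneg_left h3 h1])
      nlinarith [hy.1]
    have := add_mul_sub_le (by norm_num) (fun t ht => h.hx t (hsub ht))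
      (fun t ht => hvb t (Ioo_subset_Icc_self ht))
    linarith [hx _ m1]
  refine ⟨x, v, h, fun y hy => ⟨hx y hy, (hv y hy).le, hgap y hy, ?_⟩, hb, ?_⟩
  · rcases le_total y 0 with hy0 | hy0
    · linarith [hmono y hy 0 m0 hy0, abs_nonneg y]
    · have hsub : Icc 0 y ⊆ Icc (-N) N := Icc_subset_Icc m0.1 hy.2
      have := le_of_deriv_nonpos_of_pos (M := 4) hy0 (fun t ht => h.hasDerivAt_gap (hsub ht))
        (fun t ht => hgap t (hsub ht)) (by norm_num) (by nlinarith)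
      rw [abs_of_nonneg hy0]
      nlinarith
  · by_contra! h10
    have hI : ∀ t : ℝ, 2 ≤ t → t ≤ 10 → t ∈ Icc (-N) N := fun t h1 h2 =>
      ⟨by linarith, by linarith⟩
    have hneg : ∀ t : ℝ, 2 ≤ t → t ≤ 10 → x t * (x t ^ 2 - t) / 4 ≤ -(x t / 4) := by
      intro t h1 h2
      have h3 := hx t (hI t h1 h2)
      have h4 := hmono t (hI t h1 h2) 10 (hI 10 (by norm_num) le_rfl) h2
      have h5 : x t ^ 2 - t ≤ -1 := by nlinarith
      nlinarith [mul_le_mul_of_nonneg_left h5 h3]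
    have m6 := hI 6 (by norm_num) (by norm_num)
    have A := le_add_mul_sub (a := 6) (b := 10) (m := -(x 6 / 4)) (by norm_num)
      (fun t ht => h.hv t (hI t (by linarith [ht.1]) ht.2)) (fun t ht => by
        have := hmono 6 m6 t (hI t (by linarith [ht.1]) ht.2.le) ht.1.le
        linarith [hneg t (by linarith [ht.1]) ht.2.le])
    have B := add_mul_sub_le (a := 2) (b := 6) (m := v 6) (by norm_num)
      (fun t ht => h.hx t (hI t ht.1 (by linarith [ht.2]))) (fun t ht => by
        refine ge_of_hasDerivAt_nonpos ht.2.le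
          (fun r hr => h.hv r (hI r (by linarith [ht.1, hr.1]) (by linarith [hr.2])))
          (fun r hr => ?_)
        have h1 : 2 ≤ r := by linarith [ht.1, hr.1]
        have h2 : r ≤ 10 := by linarith [hr.2]
        linarith [hneg r h1 h2, hx r (hI r h1 h2)])
    have := hv 10 (hI 10 (by norm_num) le_rfl)
    have := hpos 2 ⟨by linarith, by linarith⟩
    linarith [hpos 6 ⟨by linarith, by linarith⟩]

/-! ### Passage to the limit -/

lemma abs_quadratic_sub_le {a b y R : ℝ} (ha : 0 ≤ a) (hb : 0 ≤ b) (haR : a ≤ R + 2)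
    (hbR : b ≤ R + 2) (hy : |y| ≤ R) :
    |(a ^ 2 + a * b + b ^ 2 - y) / 4| ≤ (R + 2) ^ 2 := by
  have hy' := abs_le.1 hy
  have hR : 0 ≤ R := (abs_nonneg y).trans hy
  have a1 := mul_le_mul haR haR ha (by linarith)
  have a2 := mul_le_mul haR hbR hb (by linarith)
  have a3 := mul_le_mul hbR hbR hb (by linarith)
  rw [abs_le]
  constructor <;> nlinarith [mul_nonneg ha hb, sq_nonneg a, sq_nonneg b, sq_nonneg R]

lemma sol_dist_le {x v x' v' : ℝ → ℝ} {R : ℝ} (h : IsSolOn x v (Icc (-R) R))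
    (h' : IsSolOn x' v' (Icc (-R) R)) (hx : ∀ y ∈ Icc (-R) R, 0 ≤ x y ∧ x y ≤ R + 2)
    (hx' : ∀ y ∈ Icc (-R) R, 0 ≤ x' y ∧ x' y ≤ R + 2) {y : ℝ} (hy : y ∈ Icc (-R) R) :
    (x y - x' y) ^ 2 + (v y - v' y) ^ 2 ≤
      ((x 0 - x' 0) ^ 2 + (v 0 - v' 0) ^ 2) * exp ((1 + (R + 2) ^ 2) * R) := by
  have hR : 0 ≤ R := by linarith [hy.1, hy.2]
  have hw : ∀ z ∈ Icc (-R) R, HasDerivAt (fun y => x y - x' y) (v z - v' z) z :=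
    fun z hz => (h.hx z hz).sub (h'.hx z hz)
  have hp : ∀ z ∈ Icc (-R) R, HasDerivAt (fun y => v y - v' y)
      ((x z ^ 2 + x z * x' z + x' z ^ 2 - z) / 4 * (x z - x' z)) z :=
    fun z hz => ((h.hv z hz).sub (h'.hv z hz)).congr_deriv (by ring)
  have hq : ∀ z ∈ Icc (-R) R, |(x z ^ 2 + x z * x' z + x' z ^ 2 - z) / 4| ≤ (R + 2) ^ 2 :=
    fun z hz => abs_quadratic_sub_le (hx z hz).1 (hx' z hz).1 (hx z hz).2 (hx' z hz).2
      (abs_le.2 hz)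
  have hd0 : 0 ≤ (x 0 - x' 0) ^ 2 + (v 0 - v' 0) ^ 2 := by positivity
  rcases le_total 0 y with h0 | h0
  · have hs : Icc 0 y ⊆ Icc (-R) R := Icc_subset_Icc (by linarith) hy.2
    refine (linear_energy_le h0 (fun z hz => hw z (hs hz)) (fun z hz => hp z (hs hz))
      (fun z hz => hq z (hs hz))).1.trans (mul_le_mul_of_nonneg_left ?_ hd0)
    exact exp_le_exp.2 (mul_le_mul_of_nonneg_left (by linarith [hy.2]) (by positivity))
  · have hs : Icc y 0 ⊆ Icc (-R) R := Icc_subset_Icc hy.1 hR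
    refine (linear_energy_le h0 (fun z hz => hw z (hs hz)) (fun z hz => hp z (hs hz))
      (fun z hz => hq z (hs hz))).2.trans (mul_le_mul_of_nonneg_left ?_ hd0)
    exact exp_le_exp.2 (mul_le_mul_of_nonneg_left (by linarith [hy.1]) (by positivity))

/-- Solutions on growing intervals with convergent data at the origin converge to a solution on the
whole line. -/
lemma exists_limit_solution {X V : ℕ → ℝ → ℝ} {a b : ℝ}
    (h : ∀ n : ℕ, IsSolOn (X n) (V n) (Icc (-(n : ℝ)) n))
    (hX : ∀ n : ℕ, ∀ y ∈ Icc (-(n : ℝ)) n, 0 ≤ X n y ∧ X n y ≤ |y| + 2)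
    (ha : Tendsto (fun n => X n 0) atTop (𝓝 a)) (hb : Tendsto (fun n => V n 0) atTop (𝓝 b)) :
    ∃ x v : ℝ → ℝ, IsSolOn x v univ ∧ (∀ y, Tendsto (fun n => X n y) atTop (𝓝 (x y))) ∧
      ∀ y, Tendsto (fun n => V n y) atTop (𝓝 (v y)) := by
  have hsub : ∀ m n : ℕ, m ≤ n → Icc (-(m : ℝ)) m ⊆ Icc (-(n : ℝ)) n := fun m n hmn => by
    have : (m : ℝ) ≤ n := by exact_mod_cast hmn
    exact Icc_subset_Icc (by linarith) this
  have hbd : ∀ m n : ℕ, m ≤ n → ∀ y ∈ Icc (-(m : ℝ)) m, 0 ≤ X n y ∧ X n y ≤ m + 2 :=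
    fun m n hmn y hy => by
      have := hX n y (hsub m n hmn hy)
      exact ⟨this.1, by linarith [this.2, abs_le.2 hy]⟩
  have hU : ∀ m : ℕ, UniformCauchySeqOn X atTop (Icc (-(m : ℝ)) m) ∧
      UniformCauchySeqOn V atTop (Icc (-(m : ℝ)) m) := by
    intro m
    set E := exp ((1 + ((m : ℝ) + 2) ^ 2) * m)
    have hE : 0 < E := exp_pos _
    have key : ∀ ε > 0, ∃ N : ℕ, ∀ i ≥ N, ∀ j ≥ N, ∀ y ∈ Icc (-(m : ℝ)) m,
        (X i y - X j y) ^ 2 + (V i y - V j y) ^ 2 < ε ^ 2 := by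
      intro ε hε
      have hη : 0 < ε / (√(2 * E)) := by positivity
      obtain ⟨N1, hN1⟩ := Metric.cauchySeq_iff.1 ha.cauchySeq _ hη
      obtain ⟨N2, hN2⟩ := Metric.cauchySeq_iff.1 hb.cauchySeq _ hη
      refine ⟨max m (max N1 N2), fun i hi j hj y hy => ?_⟩
      have hi' : m ≤ i ∧ N1 ≤ i ∧ N2 ≤ i := by simpa using hi
      have hj' : m ≤ j ∧ N1 ≤ j ∧ N2 ≤ j := by simpa using hj
      have h1 := sq_lt_sq' (neg_lt_of_abs_lt (hN1 i hi'.2.1 j hj'.2.1))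
        (lt_of_abs_lt (hN1 i hi'.2.1 j hj'.2.1))
      have h2 := sq_lt_sq' (neg_lt_of_abs_lt (hN2 i hi'.2.2 j hj'.2.2))
        (lt_of_abs_lt (hN2 i hi'.2.2 j hj'.2.2))
      rw [div_pow, Real.sq_sqrt (by positivity)] at h1 h2
      refine (sol_dist_le ((h i).mono (hsub m i hi'.1)) ((h j).mono (hsub m j hj'.1))
        (hbd m i hi'.1) (hbd m j hj'.1) hy).trans_lt ?_
      rw [← lt_div_iff₀ hE]
      calc _ < ε ^ 2 / (2 * E) + ε ^ 2 / (2 * E) := add_lt_add h1 h2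
        _ = _ := by field_simp; norm_num
    constructor <;>
    · refine Metric.uniformCauchySeqOn_iff.2 fun ε hε => ?_
      obtain ⟨N, hN⟩ := key ε hε
      refine ⟨N, fun i hi j hj y hy => ?_⟩
      rw [Real.dist_eq]
      refine abs_lt_of_sq_lt_sq ?_ hε.le
      have := hN i hi j hj y hy
      nlinarith [sq_nonneg (X i y - X j y), sq_nonneg (V i y - V j y)]
  have hmem : ∀ y : ℝ, ∃ m : ℕ, y ∈ Ioo (-(m : ℝ)) m := fun y => by
    obtain ⟨m, hm⟩ := exists_nat_gt |y|
    exact ⟨m, abs_lt.1 hm⟩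
  have hlim : ∀ y, ∃ l, Tendsto (fun n => X n y) atTop (𝓝 l) := fun y => by
    obtain ⟨m, hm⟩ := hmem y
    exact cauchySeq_tendsto_of_complete ((hU m).1.cauchySeq (Ioo_subset_Icc_self hm))
  have hlim' : ∀ y, ∃ l, Tendsto (fun n => V n y) atTop (𝓝 l) := fun y => by
    obtain ⟨m, hm⟩ := hmem y
    exact cauchySeq_tendsto_of_complete ((hU m).2.cauchySeq (Ioo_subset_Icc_self hm))
  choose x hx using hlim
  choose v hv using hlim'
  refine ⟨x, v, ⟨fun y _ => ?_, fun y _ => ?_⟩, hx, hv⟩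
  · obtain ⟨m, hm⟩ := hmem y
    refine hasDerivAt_of_tendstoUniformlyOn isOpen_Ioo
      (((hU m).2.tendstoUniformlyOn_of_tendsto fun y _ => hv y).mono Ioo_subset_Icc_self)
      ?_ (fun z _ => hx z) hm
    filter_upwards [eventually_ge_atTop m] with n hn z hz
    exact (h n).hx z (hsub m n hn (Ioo_subset_Icc_self hz))
  · obtain ⟨m, hm⟩ := hmem y
    refine hasDerivAt_of_tendstoUniformlyOn (f := V)
      (f' := fun n y => X n y * (X n y ^ 2 - y) / 4)
      (g' := fun y => x y * (x y ^ 2 - y) / 4) isOpen_Ioo ?_ ?_ (fun z _ => hv z) hm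
    · have hUx := (hU m).1.tendstoUniformlyOn_of_tendsto fun y _ => hx y
      rw [Metric.tendstoUniformlyOn_iff] at hUx ⊢
      intro ε hε
      have hQ : 0 < ((m : ℝ) + 2) ^ 2 := by positivity
      filter_upwards [hUx _ (div_pos hε hQ), eventually_ge_atTop m] with n hn hmn z hz
      have hz' := Ioo_subset_Icc_self hz
      have hbx : 0 ≤ x z ∧ x z ≤ m + 2 := by
        have hev : ∀ᶠ n in atTop, 0 ≤ X n z ∧ X n z ≤ m + 2 := by
          filter_upwards [eventually_ge_atTop m] with n hn using hbd m n hn z hz'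
        exact ⟨ge_of_tendsto (hx z) (hev.mono fun _ h => h.1),
          le_of_tendsto (hx z) (hev.mono fun _ h => h.2)⟩
      have hbn := hbd m n hmn z hz'
      have h1 := hn z hz'
      rw [Real.dist_eq, lt_div_iff₀ hQ] at h1
      have e : x z * (x z ^ 2 - z) / 4 - X n z * (X n z ^ 2 - z) / 4 =
        (x z - X n z) * ((x z ^ 2 + x z * X n z + X n z ^ 2 - z) / 4) := by ring
      rw [Real.dist_eq, e, abs_mul]
      exact (mul_le_mul_of_nonneg_left (abs_quadratic_sub_le hbx.1 hbn.1 hbx.2 hbn.2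
        (abs_le.2 hz')) (abs_nonneg _)).trans_lt h1
    · filter_upwards [eventually_ge_atTop m] with n hn z hz
      exact (h n).hv z (hsub m n hn (Ioo_subset_Icc_self hz))

lemma exists_monotone_solution :
    ∃ x v : ℝ → ℝ, IsSolOn x v univ ∧ (∀ y, 0 ≤ x y) ∧ (∀ y, 0 ≤ v y) ∧
      (∀ y, 0 < x y ^ 2 - y → 2 * x y * v y - 1 ≤ 0) ∧ 1 ≤ x 10 := by
  have hex := fun n : ℕ => exists_monotone_solution_Icc (N := n + 10) (by
    have : (0 : ℝ) ≤ n := n.cast_nonneg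
    linarith)
  choose X V hsol hprop hV hX10 using hex
  have hmem0 : ∀ n : ℕ, (0 : ℝ) ∈ Icc (-((n : ℝ) + 10)) (n + 10) := fun n => by
    have : (0 : ℝ) ≤ n := n.cast_nonneg
    exact ⟨by linarith, by linarith⟩
  have hdata : ∀ n, (X n 0, V n 0) ∈ Icc (0 : ℝ) 2 ×ˢ Icc (0 : ℝ) 5 := fun n => by
    obtain ⟨h1, h2, -, h3⟩ := hprop n 0 (hmem0 n)
    rw [abs_zero, zero_add] at h3
    exact ⟨⟨h1, h3⟩, h2, hV n⟩
  obtain ⟨⟨a, b⟩, -, φ, hφ, hlim⟩ := (isCompact_Icc.prod isCompact_Icc).tendsto_subseq hdata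
  have hsub : ∀ n : ℕ, Icc (-(n : ℝ)) n ⊆ Icc (-((φ n : ℝ) + 10)) (φ n + 10) := fun n => by
    have : (n : ℝ) ≤ φ n := by exact_mod_cast hφ.id_le n
    exact Icc_subset_Icc (by linarith) (by linarith)
  obtain ⟨x, v, h, hx, hv⟩ := exists_limit_solution (X := fun n => X (φ n)) (V := fun n => V (φ n))
    (fun n => (hsol (φ n)).mono (hsub n))
    (fun n y hy => ⟨(hprop (φ n) y (hsub n hy)).1, (hprop (φ n) y (hsub n hy)).2.2.2⟩)
    ((continuous_fst.tendsto _).comp hlim) ((continuous_snd.tendsto _).comp hlim)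
  have hev : ∀ y : ℝ, ∀ᶠ n in atTop, y ∈ Icc (-((φ n : ℝ) + 10)) (φ n + 10) := fun y => by
    obtain ⟨m, hm⟩ := exists_nat_gt |y|
    filter_upwards [eventually_ge_atTop m] with n hn
    have : (m : ℝ) ≤ n := by exact_mod_cast hn
    exact hsub n (abs_le.1 (hm.le.trans this))
  refine ⟨x, v, h, fun y => ?_, fun y => ?_, fun y hy => ?_, ?_⟩
  · exact ge_of_tendsto (hx y) ((hev y).mono fun n hn => (hprop (φ n) y hn).1)
  · exact ge_of_tendsto (hv y) ((hev y).mono fun n hn => (hprop (φ n) y hn).2.1)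
  · refine le_of_tendsto (((hx y).const_mul 2).mul (hv y) |>.sub_const 1) ?_
    filter_upwards [hev y, (((hx y).pow 2).sub_const y).eventually_const_lt hy] with n hn hpos
    exact (hprop (φ n) y hn).2.2.1 hpos
  · exact ge_of_tendsto' (hx 10) fun n => hX10 (φ n)

/-! ### Monotonicity, inflection point and asymptotics -/

namespace IsSolOn

variable {x v : ℝ → ℝ}

lemma neg {s : Set ℝ} (h : IsSolOn x v s) : IsSolOn (fun y => -x y) (fun y => -v y) s :=
  ⟨fun y hy => (h.hx y hy).neg, fun y hy => (h.hv y hy).neg.congr_deriv (by ring)⟩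

lemma contDiff (h : IsSolOn x v univ) : ContDiff ℝ (⊤ : ℕ∞) x := by
  have hx : deriv x = v := funext fun y => (h.hx y trivial).deriv
  have hv : deriv v = fun y => x y * (x y ^ 2 - y) / 4 := funext fun y => (h.hv y trivial).deriv
  have hdx : Differentiable ℝ x := fun y => (h.hx y trivial).differentiableAt
  have hdv : Differentiable ℝ v := fun y => (h.hv y trivial).differentiableAt
  have key : ∀ n : ℕ, ContDiff ℝ n x ∧ ContDiff ℝ n v := by
    intro n
    induction n with
    | zero => exact ⟨contDiff_zero.2 hdx.continuous, contDiff_zero.2 hdv.continuous⟩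
    | succ n ih =>
      push_cast
      refine ⟨contDiff_succ_iff_deriv.2 ⟨hdx, by simp, hx ▸ ih.2⟩,
        contDiff_succ_iff_deriv.2 ⟨hdv, by simp, hv ▸ ?_⟩⟩
      exact (ih.1.mul ((ih.1.pow 2).sub contDiff_id)).div_const 4
  exact contDiff_infty.2 fun n => (key n).1

lemma pos (h : IsSolOn x v univ) (hx : ∀ y, 0 ≤ x y) (h10 : 1 ≤ x 10) (y : ℝ) : 0 < x y := by
  refine lt_of_le_of_ne (hx y) fun h0 => ?_
  have hmin : IsLocalMin x y := Eventually.of_forall fun z => h0 ▸ hx z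
  have hv0 := hmin.hasDerivAt_eq_zero (h.hx y trivial)
  have := (h.mono (subset_univ (Icc (min y 10) (max y 10)))).eq_zero
    ⟨min_le_left _ _, le_max_left _ _⟩ h0.symm hv0 10 ⟨min_le_right _ _, le_max_right _ _⟩
  linarith

lemma deriv_pos (h : IsSolOn x v univ) (hx : ∀ y, 0 < x y) (hv : ∀ y, 0 ≤ v y) (y : ℝ) :
    0 < v y := by
  refine lt_of_le_of_ne (hv y) fun h0 => ?_
  have hmin : IsLocalMin v y := Eventually.of_forall fun z => h0 ▸ hv z
  have hd := hmin.hasDerivAt_eq_zero (h.hv y trivial)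
  have hgap : x y ^ 2 - y = 0 := by
    have := (hx y).ne'
    simpa [this] using hd
  obtain ⟨e, he, heI⟩ := mem_nhdsGT_iff_exists_Ioc_subset.1
    (eventually_lt_right (h.hasDerivAt_gap (mem_univ y)) (by rw [← h0]; norm_num))
  have := lt_of_hasDerivAt_pos (f := fun z => -v z) (f' := fun z => -(x z * (x z ^ 2 - z) / 4))
    (mem_Ioi.1 he) (fun z _ => (h.hv z trivial).neg) (fun z hz => by
    have h1 : x z ^ 2 - z < x y ^ 2 - y := heI ⟨hz.1, hz.2.le⟩
    nlinarith [mul_pos (hx z) (sub_pos.2 h1)])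
  linarith [hv e]

lemma strictMono (h : IsSolOn x v univ) (hv : ∀ y, 0 < v y) : StrictMono x := fun _ _ hab =>
  lt_of_hasDerivAt_pos hab (fun y _ => h.hx y trivial) (fun y _ => hv y)

lemma tendsto_atBot_zero (h : IsSolOn x v univ) (hx : ∀ y, 0 < x y) (hv : ∀ y, 0 < v y) :
    Tendsto x atBot (𝓝 0) := by
  have hm := h.strictMono hv
  refine tendsto_order.2 ⟨fun a ha => Eventually.of_forall fun y => ha.trans (hx y),
    fun L hL => ?_⟩
  suffices ∃ y, x y < L by
    obtain ⟨y, hy⟩ := this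
    filter_upwards [eventually_le_atBot y] with z hz using (hm.monotone hz).trans_lt hy
  by_contra! hge
  have hL3 : 0 < L ^ 3 / 4 := by positivity
  set y := -(v 0 / (L ^ 3 / 4)) with hy
  have hy0 : y ≤ 0 := by
    have := div_pos (hv 0) hL3
    linarith
  have := add_mul_sub_le (m := L ^ 3 / 4) hy0 (fun t _ => h.hv t trivial) (fun t ht => by
    have h1 := hge t
    have h2 : L ^ 2 ≤ x t ^ 2 - t := by nlinarith [ht.2]
    have := mul_le_mul h1 h2 (by positivity) (hx t).le
    linarith [show L * L ^ 2 = L ^ 3 by ring])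
  have e : L ^ 3 / 4 * (0 - y) = v 0 := by rw [hy]; field_simp; ring
  linarith [hv y]

lemma exists_inflection (h : IsSolOn x v univ) (hx : ∀ y, 0 < x y) (hv : ∀ y, 0 < v y)
    (hg : ∀ y, 0 < x y ^ 2 - y → 2 * x y * v y - 1 ≤ 0) :
    ∃ c, x c ^ 2 - c = 0 ∧ (∀ y, x y ^ 2 - y = 0 → y = c) ∧ ∀ y, c ≤ y → x y ^ 2 - y ≤ 0 := by
  have hgap : ∀ y, HasDerivAt (fun y => x y ^ 2 - y) (2 * x y * v y - 1) y :=
    fun y => h.hasDerivAt_gap (mem_univ y)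
  have hafter : ∀ c, x c ^ 2 - c = 0 → ∀ y, c ≤ y → x y ^ 2 - y ≤ 0 := fun c hc y hcy =>
    le_of_deriv_nonpos_of_pos (h := fun y => x y ^ 2 - y) hcy
      (fun t _ => hgap t) (fun t _ => hg t) le_rfl hc.le
  have hnot : ∀ d e, x d ^ 2 - d = 0 → x e ^ 2 - e = 0 → ¬ d < e := by
    intro d e hd he hde
    have hmax : IsLocalMax (fun y => x y ^ 2 - y) e := by
      filter_upwards [Ioi_mem_nhds hde] with y hy
      simpa only [he] using hafter d hd y (le_of_lt hy)
    have h0 := hmax.hasDerivAt_eq_zero (hgap e)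
    have := nonpos_of_max_right (show e < e + 1 by linarith) (fun y _ => hgap y)
      (h.hasDerivAt_gap_deriv (mem_univ e)) h0 (fun y hy => by
        rw [he]; exact hafter d hd y (hde.le.trans hy.1))
    rw [he] at this
    have := pow_pos (hv e) 2
    linarith
  obtain ⟨y, hy0, hy⟩ : ∃ y, 0 ≤ y ∧ x y ^ 2 - y ≤ 0 := by
    by_contra! hall
    set y := (2 + x 0 ^ 2) / v 0 ^ 2 + 1 with hy
    have hy1 : 1 ≤ y := by
      have : 0 ≤ (2 + x 0 ^ 2) / v 0 ^ 2 := by positivity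
      linarith
    have hvm : ∀ t, 0 ≤ t → v 0 ≤ v t := fun t ht =>
      le_of_hasDerivAt_nonneg ht (fun r _ => h.hv r trivial) (fun r hr => by
        have h1 := hall r hr.1.le
        have h2 := hx r
        positivity)
    have h1 := add_mul_sub_le (show 0 ≤ y by linarith) (fun t _ => h.hx t trivial)
      (fun t ht => hvm t ht.1.le)
    have h2 := le_of_deriv_nonpos_of_pos (h := fun y => x y ^ 2 - y) (M := x 0 ^ 2)
      (show 0 ≤ y by linarith)
      (fun t _ => hgap t) (fun t _ => hg t) (by positivity) (by simp)
    have h3 : v 0 * y ≤ x y := by linarith [hx 0]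
    have h4 : (v 0 * y) ^ 2 ≤ x y ^ 2 :=
      pow_le_pow_left₀ (mul_nonneg (hv 0).le (by linarith)) h3 2
    have h5 : v 0 ^ 2 * y = 2 + x 0 ^ 2 + v 0 ^ 2 := by
      have := (hv 0).ne'
      rw [hy]; field_simp
    have h6 : (v 0 * y) ^ 2 = y * (2 + x 0 ^ 2 + v 0 ^ 2) := by rw [← h5]; ring
    nlinarith [sq_nonneg (x 0), sq_nonneg (v 0)]
  have hx0 := hx 0
  obtain ⟨c, -, hc, -⟩ := exists_first_zero (f := fun y => -(x y ^ 2 - y)) hy0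
    (fun t _ => (hgap t).neg.continuousAt.continuousWithinAt) (by simp; positivity) (by linarith)
  have hc : x c ^ 2 - c = 0 := by linarith
  refine ⟨c, hc, fun y hy => ?_, hafter c hc⟩
  exact le_antisymm (not_lt.1 (hnot c y hc hy)) (not_lt.1 (hnot y c hy hc))

lemma tendsto_div_sqrt (h : IsSolOn x v univ) (hx : ∀ y, 0 < x y) (hv : ∀ y, 0 < v y)
    (h10 : 1 ≤ x 10) {c : ℝ} (hc : ∀ y, c ≤ y → x y ^ 2 - y ≤ 0) :
    Tendsto (fun y => x y / √y) atTop (𝓝 1) := by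
  have hm := h.strictMono hv
  set Y := max c 10
  have hY10 : 10 ≤ Y := le_max_right _ _
  have hgap : ∀ y, Y ≤ y → x y ^ 2 - y ≤ 0 := fun y hy => hc y ((le_max_left _ _).trans hy)
  have hx1 : ∀ y, Y ≤ y → 1 ≤ x y := fun y hy => h10.trans (hm.monotone (hY10.trans hy))
  set B := v Y
  have hvB : ∀ y, Y ≤ y → v y ≤ B := fun y hy =>
    ge_of_hasDerivAt_nonpos hy (fun t _ => h.hv t trivial) (fun t ht => by
      nlinarith [hgap t ht.1.le, hx t])
  have hk : ∀ y, 2 * Y ≤ y → y - x y ^ 2 ≤ 16 * B + 1 := by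
    intro y hy
    set k := y - x y ^ 2 with hkdef
    have hk0 : 0 ≤ k := by linarith [hgap y (by linarith)]
    have hky : k ≤ y := by linarith [sq_nonneg (x y)]
    have hlow : Y ≤ y - k / 2 := by linarith
    have hmid : ∀ t ∈ Icc (y - k / 2) y, x t ^ 2 - t ≤ -(k / 2) := by
      intro t ht
      have := add_mul_sub_le (m := -1) ht.2 (fun r _ => h.hasDerivAt_gap (mem_univ r))
        (fun r _ => by have := mul_pos (hx r) (hv r); linarith)
      linarith [ht.1]
    have := le_add_mul_sub (m := -(k / 8)) (show y - k / 2 ≤ y by linarith)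
      (fun t _ => h.hv t trivial) (fun t ht => by
        have h1 := hmid t (Ioo_subset_Icc_self ht)
        have h2 := hx1 t (by linarith [ht.1])
        nlinarith)
    have h3 := hvB _ hlow
    have h4 := hv y
    have h5 : k ^ 2 ≤ 16 * B := by nlinarith
    nlinarith
  have hsq : Tendsto (fun y => x y ^ 2 / y) atTop (𝓝 1) := by
    have hl : Tendsto (fun y : ℝ => 1 - (16 * B + 1) / y) atTop (𝓝 1) := by
      simpa using (tendsto_const_nhds (x := (1 : ℝ))).sub
        (tendsto_const_nhds (x := 16 * B + 1).div_atTop tendsto_id)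
    refine tendsto_of_tendsto_of_tendsto_of_le_of_le' hl tendsto_const_nhds ?_ ?_
    · filter_upwards [eventually_ge_atTop (2 * Y)] with y hy
      have hy0 : 0 < y := by linarith
      rw [sub_le_iff_le_add, ← add_div, le_div_iff₀ hy0]
      linarith [hk y hy]
    · filter_upwards [eventually_ge_atTop Y] with y hy
      exact (div_le_one (by linarith)).2 (by linarith [hgap y hy])
  have := (Real.continuous_sqrt.tendsto 1).comp hsq
  rw [Real.sqrt_one] at this
  refine this.congr fun y => ?_
  simp only [Function.comp_apply]
  rw [Real.sqrt_div (by positivity), Real.sqrt_sq (hx y).le]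

end IsSolOn

/-! ### Behaviour at `-∞` -/

lemma IsSolOn.tendsto_atBot {z p : ℝ → ℝ} (h : IsSolOn z p univ) (hz : ∀ y ≤ 0, 0 < z y)
    (h0 : Tendsto z atBot (𝓝 0)) :
    Tendsto p atBot (𝓝 0) ∧ Tendsto (fun y => y * z y) atBot (𝓝 0) := by
  have hp : ∀ a b, a ≤ b → b ≤ 0 → p a ≤ p b := fun a b hab hb =>
    le_of_hasDerivAt_nonneg hab (fun y _ => h.hv y trivial) (fun y hy => by
      have h1 := hz y (hy.2.le.trans hb)
      have h2 : 0 ≤ z y ^ 2 - y := by nlinarith [hy.2]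
      positivity)
  have hsub : Tendsto (fun y : ℝ => y - 1) atBot atBot :=
    tendsto_atBot_add_const_right _ (-1) tendsto_id
  have hadd : Tendsto (fun y : ℝ => y + 1) atBot atBot :=
    tendsto_atBot_add_const_right _ 1 tendsto_id
  have hp0 : Tendsto p atBot (𝓝 0) := by
    refine tendsto_of_tendsto_of_tendsto_of_le_of_le'
      (by simpa using h0.sub (h0.comp hsub)) (by simpa using (h0.comp hadd).sub h0) ?_ ?_
    · filter_upwards [eventually_le_atBot 0] with y hy
      have := le_add_mul_sub (m := p y) (show y - 1 ≤ y by linarith) (fun t _ => h.hx t trivial)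
        (fun t ht => hp t y ht.2.le hy)
      linarith
    · filter_upwards [eventually_le_atBot (-1)] with y hy
      have := add_mul_sub_le (m := p y) (show y ≤ y + 1 by linarith) (fun t _ => h.hx t trivial)
        (fun t ht => hp y t ht.1.le (by linarith [ht.2]))
      linarith
  refine ⟨hp0, ?_⟩
  have hpn : ∀ y ≤ 0, 0 ≤ p y := fun y hy => le_of_tendsto hp0 <| by
    filter_upwards [eventually_le_atBot y] with t ht using hp t y ht hy
  refine tendsto_of_tendsto_of_tendsto_of_le_of_le'
    (g := fun y => -(4 * (p (y + 1) - p y) + z y)) ?_ tendsto_const_nhds ?_ ?_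
  · simpa using ((((hp0.comp hadd).sub hp0).const_mul 4).add h0).neg
  · filter_upwards [eventually_le_atBot (-1)] with y hy
    have := add_mul_sub_le (m := z y * (-y - 1) / 4) (show y ≤ y + 1 by linarith)
      (fun t _ => h.hv t trivial) (fun t ht => by
        have h1 : z y ≤ z t := le_of_hasDerivAt_nonneg ht.1.le (fun r _ => h.hx r trivial)
          (fun r hr => hpn r (by linarith [hr.2, ht.2]))
        have h2 : -y - 1 ≤ z t ^ 2 - t := by nlinarith [ht.2]
        have := mul_le_mul h1 h2 (by linarith) (hz t (by linarith [ht.2])).le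
        linarith)
    linarith
  · filter_upwards [eventually_le_atBot 0] with y hy
    exact mul_nonpos_of_nonpos_of_nonneg hy (hz y hy).le

lemma IsSolOn.tendsto_energy {z p : ℝ → ℝ} (h : IsSolOn z p univ) (hz : ∀ y ≤ 0, 0 < z y)
    (h0 : Tendsto z atBot (𝓝 0)) :
    Tendsto (fun y => 2 * p y ^ 2 + y * z y ^ 2 / 2 - z y ^ 4 / 4) atBot (𝓝 0) := by
  obtain ⟨hp, hyz⟩ := h.tendsto_atBot hz h0
  have := (((hp.pow 2).const_mul 2).add ((hyz.mul h0).div_const 2)).sub ((h0.pow 4).div_const 4)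
  norm_num at this
  refine this.congr fun y => by ring

/-- A solution of `w'' = q w` with `q ≥ 0` on `(-∞, 0]` that decays at `-∞` either vanishes
identically or has a constant sign on `(-∞, 0]`. -/
lemma linear_trichotomy {w r q : ℝ → ℝ} (hw : ∀ y, HasDerivAt w (r y) y)
    (hr : ∀ y, HasDerivAt r (q y * w y) y) (hq : Continuous q) (hq0 : ∀ y ≤ 0, 0 ≤ q y)
    (h0 : Tendsto w atBot (𝓝 0)) :
    (∀ y, w y = 0) ∨ (∀ y ≤ 0, 0 < w y) ∨ (∀ y ≤ 0, w y < 0) := by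
  have hcont : Continuous w := continuous_iff_continuousAt.2 fun y => (hw y).continuousAt
  have hsq : ∀ y, HasDerivAt (fun y => w y ^ 2) (2 * (w y * r y)) y := fun y =>
    ((hw y).pow 2).congr_deriv (by simp; ring)
  have hwr : ∀ y, HasDerivAt (fun y => w y * r y) (r y ^ 2 + q y * w y ^ 2) y := fun y =>
    ((hw y).mul (hr y)).congr_deriv (by ring)
  have hsq0 : Tendsto (fun y => w y ^ 2) atBot (𝓝 0) := by simpa using h0.pow 2
  have hnn : ∀ y ≤ 0, 0 ≤ w y * r y := by
    intro y hy
    by_contra! hneg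
    have hne : 0 < w y ^ 2 := by
      have : w y ≠ 0 := fun h => by simp [h] at hneg
      positivity
    refine absurd (ge_of_tendsto hsq0 (b := w y ^ 2) ?_) (not_le.2 hne)
    filter_upwards [eventually_le_atBot y] with t ht
    refine ge_of_hasDerivAt_nonpos (f := fun y => w y ^ 2) ht (fun s _ => hsq s) fun s hs => ?_
    have := le_of_hasDerivAt_nonneg (f := fun y => w y * r y) hs.2.le (fun s _ => hwr s)
      (fun u hu => by
        have := hq0 u (hu.2.le.trans hy)
        positivity)
    linarith
  have hmono : ∀ a b, a ≤ b → b ≤ 0 → w a ^ 2 ≤ w b ^ 2 := fun a b hab hb =>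
    le_of_hasDerivAt_nonneg (f := fun y => w y ^ 2) hab (fun s _ => hsq s)
      (fun s hs => by linarith [hnn s (hs.2.le.trans hb)])
  by_cases hz : ∃ y ≤ 0, w y = 0
  · left
    obtain ⟨c, hc, hwc⟩ := hz
    have hzero : ∀ y ≤ c, w y = 0 := fun y hy => by
      have := hmono y c hy hc
      rw [hwc] at this
      exact pow_eq_zero_iff two_ne_zero |>.1 (le_antisymm (by simpa using this) (sq_nonneg _))
    have hmin : w =ᶠ[𝓝 (c - 1)] fun _ => 0 := by
      filter_upwards [Iio_mem_nhds (show c - 1 < c by linarith)] with y hy using hzero y hy.le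
    have hr1 : r (c - 1) = 0 :=
      (hw (c - 1)).unique ((hasDerivAt_const _ (0 : ℝ)).congr_of_eventuallyEq hmin)
    intro y
    exact linear_eq_zero (a := min y (c - 1)) (b := max y (c - 1)) ⟨min_le_right _ _,
      le_max_right _ _⟩ (fun y _ => hw y) (fun y _ => hr y) hq.continuousOn
      (hzero _ (by linarith)) hr1 y ⟨min_le_left _ _, le_max_left _ _⟩
  · right
    push Not at hz
    rcases lt_or_gt_of_ne (hz 0 le_rfl) with h | h
    · right
      intro y hy
      by_contra! hy'
      obtain ⟨c, hc, hc0, -⟩ := exists_first_zero (f := fun y => -w y) hy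
        hcont.neg.continuousOn (by have := lt_of_le_of_ne hy' (hz y hy).symm; simpa)
        (by simpa using h.le)
      exact hz c hc.2 (by simpa using hc0)
    · left
      intro y hy
      by_contra! hy'
      obtain ⟨c, hc, hc0, -⟩ := exists_first_zero (f := w) hy
        hcont.continuousOn (lt_of_le_of_ne hy' (hz y hy)) h.le
      exact hz c hc.2 hc0

/-! ### Comparison of two solutions -/

/-- A solution above `x` has an increasing ratio to `x`. -/
lemma ratio_le {x v z p : ℝ → ℝ} {c : ℝ} (h : IsSolOn x v univ) (hz : IsSolOn z p univ)
    (hx : ∀ y, 0 < x y) (hx0 : Tendsto x atBot (𝓝 0)) (hv0 : Tendsto v atBot (𝓝 0))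
    (hz0 : Tendsto z atBot (𝓝 0)) (hp0 : Tendsto p atBot (𝓝 0)) (hc : 0 ≤ c)
    (hlt : ∀ y < c, x y < z y) : z 0 / x 0 ≤ z c / x c := by
  have hW : ∀ y, HasDerivAt (fun y => p y * x y - z y * v y)
      (z y * x y * (z y ^ 2 - x y ^ 2) / 4) y := fun y =>
    (((hz.hv y trivial).mul (h.hx y trivial)).sub
      ((hz.hx y trivial).mul (h.hv y trivial))).congr_deriv (by ring)
  have hW0 : Tendsto (fun y => p y * x y - z y * v y) atBot (𝓝 0) := by
    simpa using (hp0.mul hx0).sub (hz0.mul hv0)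
  have hWn : ∀ y ≤ c, 0 ≤ p y * x y - z y * v y := fun y hy => le_of_tendsto hW0 <| by
    filter_upwards [eventually_le_atBot y] with t ht
    refine le_of_hasDerivAt_nonneg (f := fun y => p y * x y - z y * v y) ht (fun s _ => hW s)
      fun s hs => ?_
    have h1 := hx s
    have h2 := hlt s (hs.2.trans_le hy)
    have h3 : 0 ≤ z s ^ 2 - x s ^ 2 := by nlinarith
    have h4 : 0 < z s := h1.trans h2
    positivity
  exact le_of_hasDerivAt_nonneg (f := fun y => z y / x y) hc
    (fun y _ => (hz.hx y trivial).div (h.hx y trivial) (hx y).ne')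
    (fun y hy => div_nonneg (hWn y hy.2.le) (sq_nonneg _))

/-- Two distinct ordered solutions with the same asymptotics at `+∞` approach each other
exponentially fast, so their energies cannot stay apart. -/
lemma not_lt_of_energy_gap {x v u p : ℝ → ℝ} {c δ : ℝ} (h : IsSolOn x v univ)
    (hu : IsSolOn u p univ) (hv : ∀ y, 0 < v y) (hc : ∀ y, c ≤ y → x y ^ 2 - y ≤ 0)
    (hxl : Tendsto (fun y => x y / √y) atTop (𝓝 1))
    (hul : Tendsto (fun y => u y / √y) atTop (𝓝 1)) (hlt : ∀ y, 0 ≤ y → u y < x y)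
    (hD : ∀ y, 0 ≤ y → δ ≤ (2 * v y ^ 2 + y * x y ^ 2 / 2 - x y ^ 4 / 4) -
      (2 * p y ^ 2 + y * u y ^ 2 / 2 - u y ^ 4 / 4)) : δ ≤ 0 := by
  obtain ⟨Y, hY⟩ := eventually_atTop.1 ((hxl.eventually_const_lt (show (9 / 10 : ℝ) < 1 by
    norm_num)).and (hul.eventually_const_lt (show (9 / 10 : ℝ) < 1 by norm_num)))
  set Y' := max (max Y c) 4
  have hY4 : 4 ≤ Y' := le_max_right _ _
  have hYc : c ≤ Y' := (le_max_right _ _).trans (le_max_left _ _)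
  have hYY : Y ≤ Y' := (le_max_left _ _).trans (le_max_left _ _)
  have hlow : ∀ y, Y' ≤ y → 9 / 10 * √y < x y ∧ 9 / 10 * √y < u y := fun y hy => by
    have hs : 0 < √y := Real.sqrt_pos.2 (by linarith)
    exact ⟨(lt_div_iff₀ hs).1 (hY y (hYY.trans hy)).1, (lt_div_iff₀ hs).1 (hY y (hYY.trans hy)).2⟩
  have hup : ∀ y, Y' ≤ y → 0 < u y := fun y hy =>
    lt_of_le_of_lt (by positivity) (hlow y hy).2
  have hq : ∀ y, Y' ≤ y → 1 ≤ (x y ^ 2 + x y * u y + u y ^ 2 - y) / 4 := fun y hy => by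
    obtain ⟨h1, h2⟩ := hlow y hy
    have hs := Real.sq_sqrt (show 0 ≤ y by linarith)
    have hs0 := Real.sqrt_nonneg y
    nlinarith [mul_le_mul h1.le h2.le (by positivity) (by linarith),
      mul_le_mul h1.le h1.le (by positivity) (by linarith),
      mul_le_mul h2.le h2.le (by positivity) (by linarith)]
  set w : ℝ → ℝ := fun y => x y - u y with hwdef
  set r : ℝ → ℝ := fun y => v y - p y with hrdef
  have hw : ∀ y, HasDerivAt w (r y) y := fun y => (h.hx y trivial).sub (hu.hx y trivial)
  have hr : ∀ y, HasDerivAt r ((x y ^ 2 + x y * u y + u y ^ 2 - y) / 4 * w y) y := fun y =>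
    ((h.hv y trivial).sub (hu.hv y trivial)).congr_deriv (by simp only [hwdef]; ring)
  have hwp : ∀ y, Y' ≤ y → 0 < w y := fun y hy => sub_pos.2 (hlt y (by linarith))
  have hrw : ∀ y, Y' ≤ y → w y ≤ (x y ^ 2 + x y * u y + u y ^ 2 - y) / 4 * w y := fun y hy =>
    le_mul_of_one_le_left (hwp y hy).le (hq y hy)
  have hrm : ∀ a b, Y' ≤ a → a ≤ b → r a ≤ r b := fun a b ha hab =>
    le_of_hasDerivAt_nonneg hab (fun y _ => hr y) fun y hy =>
      (hwp y (ha.trans hy.1.le)).le.trans (hrw y (ha.trans hy.1.le))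
  have hrn : ∀ y, Y' ≤ y → r y ≤ 0 := by
    intro y hy
    by_contra! hpos
    set s := (1 + y) / r y ^ 2 + 1 with hs
    have hs1 : 1 ≤ s := by
      have : 0 ≤ (1 + y) / r y ^ 2 := div_nonneg (by linarith) (sq_nonneg _)
      linarith
    have h1 := add_mul_sub_le (m := r y) (show y ≤ y + s by linarith) (fun t _ => hw t)
      (fun t ht => hrm y t hy ht.1.le)
    have h2 : r y * s ≤ x (y + s) := by
      have := hup (y + s) (by linarith)
      have h3 := hwp y hy
      simp only [hwdef] at h1 h3
      linarith
    have h3 : (r y * s) ^ 2 ≤ y + s :=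
      (pow_le_pow_left₀ (by positivity) h2 2).trans (by linarith [hc (y + s) (by linarith)])
    have h4 : r y ^ 2 * s = 1 + y + r y ^ 2 := by rw [hs]; field_simp
    have h5 : (r y * s) ^ 2 = s * (1 + y + r y ^ 2) := by rw [← h4]; ring
    nlinarith [pow_pos hpos 2]
  have hUn : ∀ y, Y' ≤ y → r y + w y ≤ 0 := by
    intro y hy
    by_contra! hpos
    have hU : ∀ t, y ≤ t → r y + w y ≤ r t + w t := by
      intro t ht
      have := le_of_hasDerivAt_nonneg (f := fun s => (r s + w s) * exp (y - s))
        (f' := fun s => ((x s ^ 2 + x s * u s + u s ^ 2 - s) / 4 * w s - w s) * exp (y - s)) ht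
        (fun s _ => by
          refine (((hr s).add (hw s)).mul ((hasDerivAt_id s).const_sub y).exp).congr_deriv ?_
          simp; ring)
        (fun s hs => mul_nonneg (by linarith [hrw s (hy.trans hs.1.le)]) (exp_pos _).le)
      simp only [sub_self, exp_zero, mul_one] at this
      have h1 : exp (y - t) ≤ 1 := exp_le_one_iff.2 (by linarith)
      have h2 : 0 < r t + w t := by
        by_contra! hn
        nlinarith [exp_pos (y - t)]
      nlinarith
    have hy1 : 0 ≤ (1 - r y) / (r y + w y) := div_nonneg (by linarith [hrn y hy]) hpos.le
    have h1 := add_mul_sub_le (m := r y + w y)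
      (show y ≤ y + (1 - r y) / (r y + w y) by linarith) (fun t _ => hr t) (fun t ht => by
        have h2 := hy.trans ht.1.le
        linarith [hU t ht.1.le, hrn t h2, hrw t h2])
    have h2 : (r y + w y) * (y + (1 - r y) / (r y + w y) - y) = 1 - r y := by
      rw [add_sub_cancel_left, mul_div_cancel₀ _ hpos.ne']
    linarith [hrn (y + (1 - r y) / (r y + w y)) (by linarith)]
  have hwe : ∀ y, Y' ≤ y → w y ≤ w Y' * exp Y' * exp (-y) := by
    intro y hy
    have := ge_of_hasDerivAt_nonpos (f := fun s => w s * exp s)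
      (f' := fun s => (r s + w s) * exp s) hy
      (fun s _ => ((hw s).mul (Real.hasDerivAt_exp s)).congr_deriv (by ring))
      (fun s hs => mul_nonpos_of_nonpos_of_nonneg (hUn s hs.1.le) (exp_pos _).le)
    rwa [exp_neg, ← div_eq_mul_inv, le_div_iff₀ (exp_pos _)]
  have hlim : Tendsto (fun y : ℝ => w Y' * exp Y' * (y ^ 2 * exp (-y))) atTop (𝓝 0) := by
    simpa using (Real.tendsto_pow_mul_exp_neg_atTop_nhds_zero 2).const_mul (w Y' * exp Y')
  refine ge_of_tendsto hlim ?_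
  filter_upwards [eventually_ge_atTop Y'] with y hy
  refine (hD y (by linarith)).trans ?_
  have hwy := hwp y hy
  have hu0 := hup y hy
  have hry := hrn y hy
  have hvy := hv y
  have hxy : x y ≤ y := by nlinarith [hc y (hYc.trans hy)]
  have e1 : v y ^ 2 - p y ^ 2 ≤ 0 := by
    have : v y ^ 2 - p y ^ 2 = r y * (2 * v y - r y) := by simp only [hrdef]; ring
    rw [this]
    exact mul_nonpos_of_nonpos_of_nonneg hry (by linarith)
  have hxu : x y = u y + w y := by simp only [hwdef]; ring
  have e2 : u y ^ 2 ≤ x y ^ 2 := pow_le_pow_left₀ hu0.le (by linarith) 2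
  have e3 : u y ^ 4 ≤ x y ^ 4 := pow_le_pow_left₀ hu0.le (by linarith) 4
  have e4 : (x y ^ 2 - u y ^ 2) * y / 2 ≤ w y * y ^ 2 := by
    have a1 : x y ^ 2 - u y ^ 2 = w y * (x y + u y) := by simp only [hwdef]; ring
    rw [a1]
    have : w y * ((x y + u y) * y) ≤ w y * (2 * y * y) :=
      mul_le_mul_of_nonneg_left (mul_le_mul_of_nonneg_right (by linarith) (by linarith)) hwy.le
    linarith
  have e5 := mul_le_mul_of_nonneg_right (hwe y hy) (sq_nonneg y)
  linarith

/-- A monotone Hastings-McLeod solution is the only solution, up to sign, with its asymptotics. -/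
lemma eq_of_pos {x v z p : ℝ → ℝ} {c σ : ℝ} (h : IsSolOn x v univ) (hx : ∀ y, 0 < x y)
    (hv : ∀ y, 0 < v y) (hc : ∀ y, c ≤ y → x y ^ 2 - y ≤ 0)
    (hxl : Tendsto (fun y => x y / √y) atTop (𝓝 1)) (hx0 : Tendsto x atBot (𝓝 0))
    (hz : IsSolOn z p univ) (hzp : ∀ y ≤ 0, 0 < z y) (hσ : σ = 1 ∨ σ = -1)
    (hzl : Tendsto (fun y => z y / √y) atTop (𝓝 σ)) (hz0 : Tendsto z atBot (𝓝 0)) : z = x := by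
  have hv0 := (h.tendsto_atBot (fun y _ => hx y) hx0).1
  have hp0 := (hz.tendsto_atBot hzp hz0).1
  have hxc : Continuous x := continuous_iff_continuousAt.2 fun y => (h.hx y trivial).continuousAt
  have hzc : Continuous z := continuous_iff_continuousAt.2 fun y => (hz.hx y trivial).continuousAt
  rcases linear_trichotomy (w := fun y => x y - z y) (r := fun y => v y - p y)
    (q := fun y => (x y ^ 2 + x y * z y + z y ^ 2 - y) / 4)
    (fun y => (h.hx y trivial).sub (hz.hx y trivial))
    (fun y => ((h.hv y trivial).sub (hz.hv y trivial)).congr_deriv (by ring)) (by fun_prop)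
    (fun y hy => by
      have h1 := hx y
      have h2 := hzp y hy
      have h3 : 0 ≤ x y ^ 2 + x y * z y + z y ^ 2 := by positivity
      linarith) (by simpa using hx0.sub hz0) with h1 | h1 | h1
  · exact funext fun y => (sub_eq_zero.1 (h1 y)).symm
  · exfalso
    have hE : ∀ y, HasDerivAt (fun y => (2 * v y ^ 2 + y * x y ^ 2 / 2 - x y ^ 4 / 4) -
        (2 * p y ^ 2 + y * z y ^ 2 / 2 - z y ^ 4 / 4)) (x y ^ 2 / 2 - z y ^ 2 / 2) y := fun y =>
      (h.hasDerivAt_energy trivial).sub (hz.hasDerivAt_energy trivial)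
    have hEl := (h.tendsto_energy (fun y _ => hx y) hx0).sub (hz.tendsto_energy hzp hz0)
    rw [sub_zero] at hEl
    set D : ℝ → ℝ := fun y => (2 * v y ^ 2 + y * x y ^ 2 / 2 - x y ^ 4 / 4) -
        (2 * p y ^ 2 + y * z y ^ 2 / 2 - z y ^ 4 / 4) with hDdef
    have hsq : ∀ y ≤ 0, z y ^ 2 < x y ^ 2 := fun y hy =>
      pow_lt_pow_left₀ (sub_pos.1 (h1 y hy)) (hzp y hy).le two_ne_zero
    have hD0 : 0 < D 0 := by
      have a1 : D (-1) < D 0 := lt_of_hasDerivAt_pos (by norm_num) (fun y _ => hE y)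
        (fun y hy => by linarith [hsq y hy.2.le])
      refine lt_of_le_of_lt (le_of_tendsto hEl ?_) a1
      filter_upwards [eventually_le_atBot (-1)] with t ht
      exact le_of_hasDerivAt_nonneg (f := D) ht (fun y _ => hE y)
        (fun y hy => by linarith [hsq y (by linarith [hy.2])])
    have hDm : ∀ b, 0 ≤ b → (∀ y ∈ Ico 0 b, z y ^ 2 < x y ^ 2) → D 0 ≤ D b := fun b hb hlt =>
      le_of_hasDerivAt_nonneg (f := D) hb (fun y _ => hE y)
        (fun y hy => by linarith [hlt y (Ioo_subset_Ico_self hy)])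
    have hall : ∀ y, 0 ≤ y → z y ^ 2 < x y ^ 2 := by
      intro y hy
      by_contra! hge
      obtain ⟨e, he, he0, hlt⟩ := exists_first_zero (f := fun y => z y ^ 2 - x y ^ 2) hy
        (by fun_prop) (by linarith [hsq 0 le_rfl]) (by linarith)
      have hDe := hDm e he.1.le fun t ht => by linarith [hlt t ht]
      have hze : z e ^ 2 = x e ^ 2 := by linarith
      have hz4 : z e ^ 4 = x e ^ 4 := by
        rw [show z e ^ 4 = (z e ^ 2) ^ 2 by ring, hze]; ring
      have hpv : p e ^ 2 < v e ^ 2 := by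
        simp only [hDdef, hze, hz4] at hDe hD0
        linarith
      have hprod : z e * p e < x e * v e := by
        refine lt_of_pow_lt_pow_left₀ 2 (mul_pos (hx e) (hv e)).le ?_
        rw [mul_pow, mul_pow, hze]
        exact mul_lt_mul_of_pos_left hpv (pow_pos (hx e) 2)
      have hd : HasDerivAt (fun y => z y ^ 2 - x y ^ 2) (2 * (z e * p e) - 2 * (x e * v e)) e :=
        (((hz.hx e trivial).pow 2).sub ((h.hx e trivial).pow 2)).congr_deriv (by simp; ring)
      obtain ⟨t, ht, htm⟩ := ((eventually_gt_left hd (by linarith)).and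
        (Ioo_mem_nhdsLT he.1)).exists
      have := hlt t (Ioo_subset_Ico_self htm)
      linarith
    have hDall : ∀ y, 0 ≤ y → D 0 ≤ D y := fun y hy => hDm y hy fun t ht => hall t ht.1
    refine absurd ?_ (not_le.2 hD0)
    rcases hσ with rfl | rfl
    · exact not_lt_of_energy_gap h hz hv hc hxl hzl
        (fun y hy => lt_of_pow_lt_pow_left₀ 2 (hx y).le (hall y hy)) hDall
    · refine not_lt_of_energy_gap h hz.neg hv hc hxl ?_
        (fun y hy => lt_of_pow_lt_pow_left₀ 2 (hx y).le (by simpa using hall y hy))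
        (fun y hy => ?_)
      · simpa [neg_div] using hzl.neg
      · have := hDall y hy
        simp only [hDdef] at this ⊢
        rw [neg_sq, neg_sq, Even.neg_pow (by decide)]
        exact this
  · exfalso
    have hlt0 : ∀ y ≤ 0, x y < z y := fun y hy => sub_neg.1 (h1 y hy)
    have hρ : 1 < z 0 / x 0 := (one_lt_div (hx 0)).2 (hlt0 0 le_rfl)
    have hall : ∀ y, x y < z y := by
      intro y
      rcases le_total y 0 with hy | hy
      · exact hlt0 y hy
      by_contra! hge
      obtain ⟨e, he, he0, hlt⟩ := exists_first_zero (f := fun y => x y - z y) hy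
        (by fun_prop) (h1 0 le_rfl) (sub_nonneg.2 hge)
      have := ratio_le h hz hx hx0 hv0 hz0 hp0 he.1.le (fun t ht => by
        rcases le_total t 0 with ht0 | ht0
        · exact hlt0 t ht0
        · exact sub_neg.1 (hlt t ⟨ht0, ht⟩))
      rw [← sub_eq_zero.1 he0, div_self (hx e).ne'] at this
      linarith
    have hle : z 0 / x 0 * 1 ≤ σ := by
      refine le_of_tendsto_of_tendsto (hxl.const_mul _) hzl ?_
      filter_upwards [eventually_ge_atTop 0] with y hy
      have := ratio_le h hz hx hx0 hv0 hz0 hp0 hy (fun t _ => hall t)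
      rw [le_div_iff₀ (hx y)] at this
      rw [← mul_div_assoc]
      exact div_le_div_of_nonneg_right this (Real.sqrt_nonneg y)
    rcases hσ with rfl | rfl <;> linarith

lemma eq_of_asymptotics {x v u p : ℝ → ℝ} {c : ℝ} (h : IsSolOn x v univ) (hx : ∀ y, 0 < x y)
    (hv : ∀ y, 0 < v y) (hc : ∀ y, c ≤ y → x y ^ 2 - y ≤ 0)
    (hxl : Tendsto (fun y => x y / √y) atTop (𝓝 1)) (hx0 : Tendsto x atBot (𝓝 0))
    (hu : IsSolOn u p univ) (hul : Tendsto (fun y => u y / √y) atTop (𝓝 1))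
    (hu0 : Tendsto u atBot (𝓝 0)) : u = x := by
  have huc : Continuous u := continuous_iff_continuousAt.2 fun y => (hu.hx y trivial).continuousAt
  rcases linear_trichotomy (q := fun y => (u y ^ 2 - y) / 4) (fun y => hu.hx y trivial)
    (fun y => (hu.hv y trivial).congr_deriv (by ring)) (by fun_prop)
    (fun y hy => by linarith [sq_nonneg (u y)]) hu0 with h1 | h1 | h1
  · simp only [h1, zero_div] at hul
    exact absurd (tendsto_nhds_unique hul tendsto_const_nhds) one_ne_zero
  · exact eq_of_pos h hx hv hc hxl hx0 hu h1 (.inl rfl) hul hu0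
  · have hnl : Tendsto (fun y => -u y / √y) atTop (𝓝 (-1)) := by simpa [neg_div] using hul.neg
    have := eq_of_pos h hx hv hc hxl hx0 hu.neg (fun y hy => neg_pos.2 (h1 y hy)) (.inr rfl)
      hnl (by simpa using hu0.neg)
    subst this
    have := tendsto_nhds_unique hxl hnl
    norm_num at this

end PainleveII

/-- The Painlevé-II equation `4ν'' + yν − ν³ = 0` on `ℝ` admits a unique
solution `ν₀ ∈ C^∞(ℝ)` such that `ν₀(y)/√y → 1` as `y → +∞` and `ν₀(y) → 0` as `y → −∞`.
Moreover, this solution is strictly increasing on `ℝ` and its second derivative has exactly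
one zero on `ℝ`. -/
theorem painleveII_hastingsMcLeod_exists_unique :
    ∃ ν₀ : ℝ → ℝ,
      (ContDiff ℝ (⊤ : ℕ∞) ν₀ ∧
        (∀ y : ℝ, 4 * deriv (deriv ν₀) y + y * ν₀ y - (ν₀ y) ^ 3 = 0) ∧
        Tendsto (fun y : ℝ => ν₀ y / Real.sqrt y) atTop (nhds 1) ∧
        Tendsto ν₀ atBot (nhds 0)) ∧
      (∀ ν : ℝ → ℝ,
        (ContDiff ℝ (⊤ : ℕ∞) ν ∧
          (∀ y : ℝ, 4 * deriv (deriv ν) y + y * ν y - (ν y) ^ 3 = 0) ∧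
          Tendsto (fun y : ℝ => ν y / Real.sqrt y) atTop (nhds 1) ∧
          Tendsto ν atBot (nhds 0)) → ν = ν₀) ∧
      StrictMono ν₀ ∧
      (∃! y : ℝ, deriv (deriv ν₀) y = 0) := by
  obtain ⟨x, v, h, hx, hv, hg, h10⟩ := PainleveII.exists_monotone_solution
  replace hx := h.pos hx h10
  replace hv := h.deriv_pos hx hv
  obtain ⟨c, hc, hcu, hca⟩ := h.exists_inflection hx hv hg
  have hxl := h.tendsto_div_sqrt hx hv h10 hca
  have hx0 := h.tendsto_atBot_zero hx hv
  have hd : deriv x = v := funext fun y => (h.hx y trivial).deriv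
  have hd2 : ∀ y, deriv (deriv x) y = x y * (x y ^ 2 - y) / 4 := fun y => by
    rw [hd, (h.hv y trivial).deriv]
  refine ⟨x, ⟨h.contDiff, fun y => by rw [hd2]; ring, hxl, hx0⟩, ?_, h.strictMono hv, c, ?_, ?_⟩
  · rintro ν ⟨hν, hode, hνl, hν0⟩
    refine PainleveII.eq_of_asymptotics (p := deriv ν) h hx hv hca hxl hx0 ⟨fun y _ => ?_,
      fun y _ => ?_⟩ hνl hν0
    · exact (hν.differentiable (by simp) y).hasDerivAt
    · refine (((contDiff_infty.1 hν 2).differentiable_deriv_two y).hasDerivAt).congr_deriv ?_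
      linarith [hode y]
  · simp only [hd2, hc, mul_zero, zero_div]
  · intro y hy
    refine hcu y ?_
    simpa [hd2, (hx y).ne'] using hy
end

section
/- Let ν₀ ∈ C^∞(ℝ) be a positive, strictly increasing solution of 4ν''(y) + y ν(y) − ν(y)³ = 0 such that ν₀(y)/y^{1/2} → 1 as y → +∞, ν₀(y) → 0 as y → −∞, and ν₀'' has exactly one zero on ℝ. Then inf_{y ∈ ℝ} (3ν₀(y)² − y) > 0. -/
open Filter Real

/-- A function with nonpositive derivative on `[a, b]` satisfies `f b ≤ f a`. -/
theorem le_of_hasDerivAt_nonpos {f f' : ℝ → ℝ} {a b : ℝ} (hab : a ≤ b)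
    (hf : ∀ x, HasDerivAt f (f' x) x) (hf' : ∀ x, a ≤ x → x ≤ b → f' x ≤ 0) : f b ≤ f a := by
  refine antitoneOn_of_deriv_nonpos (convex_Icc a b)
    (fun x _ => (hf x).continuousAt.continuousWithinAt)
    (fun x _ => (hf x).differentiableAt.differentiableWithinAt) (fun x hx => ?_)
    (Set.left_mem_Icc.2 hab) (Set.right_mem_Icc.2 hab) hab
  rw [interior_Icc] at hx
  rw [(hf x).deriv]
  exact hf' x hx.1.le hx.2.le

/-- The slope of a nonnegative, nondecreasing solution at a point `a = v a ^ 2` is controlled by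
its value there, by comparison with the subsolution `(y - (a - 7 / 2)) ^ 2` of an Airy equation. -/
theorem painleve_slope_le {v u : ℝ → ℝ} {a : ℝ} (hpos : ∀ y, 0 < v y) (hmono : Monotone v)
    (hv : ∀ y, HasDerivAt v (u y) y) (hu : ∀ y, HasDerivAt u (v y * (v y ^ 2 - y) / 4) y)
    (ha : v a ^ 2 = a) : u a ≤ 4 / 7 * v a := by
  have hM : ∀ y, HasDerivAt
      (fun y => u y * (y - (a - 7 / 2)) ^ 2 - v y * (2 * (y - (a - 7 / 2))))
      (v y * ((v y ^ 2 - y) / 4 * (y - (a - 7 / 2)) ^ 2 - 2)) y := by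
    intro y
    have hl : HasDerivAt (fun y => y - (a - 7 / 2)) 1 y := (hasDerivAt_id y).sub_const _
    refine (((hu y).mul (hl.pow 2)).sub ((hv y).mul (hl.const_mul 2))).congr_deriv ?_
    simp
    ring
  have h := le_of_hasDerivAt_nonpos (a := a - 7 / 2) (b := a) (by linarith) hM (by
    intro y h1 h2
    refine mul_nonpos_of_nonneg_of_nonpos (hpos y).le ?_
    have h3 : v y ^ 2 ≤ a := by
      rw [← ha]
      exact pow_le_pow_left₀ (hpos y).le (hmono h2) 2
    have h4 : (v y ^ 2 - y) / 4 * (y - (a - 7 / 2)) ^ 2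
        ≤ (a - y) / 4 * (y - (a - 7 / 2)) ^ 2 := by gcongr
    obtain ⟨t, rfl⟩ : ∃ t, y = a - t := ⟨a - y, by ring⟩
    have ht : 0 ≤ t := by linarith
    have h5 : t * (7 / 2 - t) ^ 2 ≤ 8 := by
      nlinarith [mul_nonneg (show (0 : ℝ) ≤ 14 / 3 - t by linarith) (sq_nonneg (t - 7 / 6))]
    have h6 : (a - (a - t)) / 4 * (a - t - (a - 7 / 2)) ^ 2 = t * (7 / 2 - t) ^ 2 / 4 := by ring
    linarith)
  norm_num at h
  linarith

/-- To the right of a point `a = v a ^ 2` after which `v ^ 2 ≤ y`, the energy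
`2 * v' ^ 2 - (v ^ 2 - y) ^ 2 / 4` of an increasing solution is nonnegative. -/
theorem painleve_energy_nonneg {v u : ℝ → ℝ} {a : ℝ} (hpos : ∀ y, 0 < v y) (hmono : Monotone v)
    (hu : ∀ y, HasDerivAt u (v y * (v y ^ 2 - y) / 4) y)
    (hE : ∀ y, HasDerivAt (fun y => 2 * u y ^ 2 - (v y ^ 2 - y) ^ 2 / 4) ((v y ^ 2 - y) / 2) y)
    (hu0 : ∀ y, 0 ≤ u y) (hr : ∀ y, a ≤ y → v y ^ 2 ≤ y) {b : ℝ} (hb : a ≤ b) :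
    0 ≤ 2 * u b ^ 2 - (v b ^ 2 - b) ^ 2 / 4 := by
  by_contra! hneg
  obtain ⟨k, hk, hk2⟩ : ∃ k > 0, k ^ 2 = -4 * (2 * u b ^ 2 - (v b ^ 2 - b) ^ 2 / 4) :=
    ⟨√(-4 * (2 * u b ^ 2 - (v b ^ 2 - b) ^ 2 / 4)), Real.sqrt_pos.2 (by linarith),
      Real.sq_sqrt (by linarith)⟩
  have hd : ∀ y, b ≤ y → k ≤ y - v y ^ 2 := by
    intro y hy
    have h1 := le_of_hasDerivAt_nonpos hy hE
      (fun x hx _ => by linarith [hr x (hb.trans hx)])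
    have h2 := hr y (hb.trans hy)
    refine le_of_sq_le_sq ?_ (by linarith)
    nlinarith [sq_nonneg (u y)]
  have hC : 0 < v b * k / 4 := by have := hpos b; positivity
  have hlin : ∀ y, HasDerivAt (fun y => u y + v b * k / 4 * y)
      (v y * (v y ^ 2 - y) / 4 + v b * k / 4) y := by
    intro y
    exact ((hu y).add ((hasDerivAt_id y).const_mul (v b * k / 4))).congr_deriv (by simp)
  set T := (u b + 1) / (v b * k / 4) with hT
  have hTC : v b * k / 4 * T = u b + 1 := mul_div_cancel₀ _ hC.ne'
  have hT0 : 0 ≤ T := div_nonneg (by linarith [hu0 b]) hC.le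
  have h := le_of_hasDerivAt_nonpos (a := b) (b := b + T) (by linarith) hlin (by
    intro y hy _
    have h1 := mul_le_mul (hmono hy) (hd y hy) hk.le (hpos y).le
    nlinarith)
  have := hu0 (b + T)
  nlinarith

/-- Lemma `V0below`. For the Hastings–McLeod solution `ν₀` of the
Painlevé-II equation, `inf_{y∈ℝ} (3ν₀(y)² − y) > 0`. -/
theorem W0_positive_infimum
    (ν₀ : ℝ → ℝ)
    (hsmooth : ContDiff ℝ (⊤ : ℕ∞) ν₀)
    (hpos : ∀ y : ℝ, 0 < ν₀ y)
    (hmono : StrictMono ν₀)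
    (hode : ∀ y : ℝ, 4 * deriv (deriv ν₀) y + y * ν₀ y - (ν₀ y) ^ 3 = 0)
    (htop : Tendsto (fun y : ℝ => ν₀ y / Real.sqrt y) atTop (nhds 1))
    (hbot : Tendsto ν₀ atBot (nhds 0))
    (hinfl : ∃! y : ℝ, deriv (deriv ν₀) y = 0) :
    ∃ c > (0:ℝ), ∀ y : ℝ, c ≤ 3 * (ν₀ y) ^ 2 - y := by
  obtain ⟨a, ha0, hauniq⟩ := hinfl
  have hv : ∀ y, HasDerivAt ν₀ (deriv ν₀ y) y := fun y =>
    (hsmooth.differentiable (by simp) y).hasDerivAt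
  have hsmooth' : ContDiff ℝ (⊤ : ℕ∞) (deriv ν₀) :=
    (contDiff_infty_iff_deriv.1 hsmooth).2
  have hdd : ∀ y, deriv (deriv ν₀) y = ν₀ y * (ν₀ y ^ 2 - y) / 4 := fun y => by
    linarith [hode y]
  have hu : ∀ y, HasDerivAt (deriv ν₀) (ν₀ y * (ν₀ y ^ 2 - y) / 4) y := fun y => by
    rw [← hdd y]
    exact (hsmooth'.differentiable (by simp) y).hasDerivAt
  have hu0 : ∀ y, 0 ≤ deriv ν₀ y := fun y => hmono.monotone.deriv_nonneg
  have hzero : ∀ y, ν₀ y ^ 2 - y = 0 → y = a := fun y hy =>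
    hauniq y (by simp only [hdd y, hy]; simp)
  have ha : ν₀ a ^ 2 = a := by
    have h1 : ν₀ a * (ν₀ a ^ 2 - a) = 0 := by linarith [hdd a]
    have h2 := (mul_eq_zero.1 h1).resolve_left (hpos a).ne'
    linarith
  have hapos : 0 < a := by rw [← ha]; exact pow_pos (hpos a) 2
  have hcont : Continuous fun y => ν₀ y ^ 2 - y :=
    (hsmooth.continuous.pow 2).sub continuous_id
  have hleft : ∀ y, y ≤ a → y ≤ ν₀ y ^ 2 := by
    intro y hy
    by_contra! hlt
    have hy0 : 0 ≤ y := (sq_nonneg (ν₀ y)).trans hlt.le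
    obtain ⟨z, hz, hz0⟩ := intermediate_value_Icc' hy0 hcont.continuousOn
      (show (0 : ℝ) ∈ Set.Icc _ _ from ⟨by linarith, by nlinarith [hpos 0]⟩)
    have hza := hzero z hz0
    have hya : y = a := le_antisymm hy (hza ▸ hz.2)
    rw [hya] at hlt
    linarith
  have hlow : ∀ y, y ≤ ν₀ y ^ 2 → min 1 (2 * ν₀ (-1) ^ 2) ≤ 3 * ν₀ y ^ 2 - y := by
    intro y hy
    rcases le_total y (-1) with h | h
    · exact (min_le_left _ _).trans (by nlinarith [sq_nonneg (ν₀ y)])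
    · have h1 := pow_le_pow_left₀ (hpos _).le (hmono.monotone h) 2
      exact (min_le_right _ _).trans (by linarith)
  have hlowpos : 0 < min 1 (2 * ν₀ (-1) ^ 2) :=
    lt_min one_pos (mul_pos two_pos (pow_pos (hpos _) 2))
  by_cases hcase : ∃ y, a < y ∧ ν₀ y ^ 2 < y
  swap
  · push Not at hcase
    refine ⟨_, hlowpos, fun y => hlow y ?_⟩
    rcases le_or_gt y a with h | h
    · exact hleft y h
    · exact hcase y h
  obtain ⟨q, hqa, hq⟩ := hcase
  have hr : ∀ y, a ≤ y → ν₀ y ^ 2 ≤ y := by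
    intro y hy
    by_contra! hlt
    have hay : a < y := lt_of_le_of_ne hy (fun h => by rw [← h] at hlt; linarith)
    obtain ⟨z, hz, hz0⟩ := intermediate_value_uIcc (a := q) (b := y) hcont.continuousOn
      (show (0 : ℝ) ∈ Set.uIcc _ _ from Set.mem_uIcc.2 (Or.inl ⟨by linarith, by linarith⟩))
    have hza := hzero z hz0
    have h1 : min q y ≤ z := hz.1
    have h2 : a < min q y := lt_min hqa hay
    linarith
  have hE : ∀ y, HasDerivAt (fun y => 2 * deriv ν₀ y ^ 2 - (ν₀ y ^ 2 - y) ^ 2 / 4)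
      ((ν₀ y ^ 2 - y) / 2) y := by
    intro y
    refine ((((hu y).pow 2).const_mul 2).sub
      (((((hv y).pow 2).sub (hasDerivAt_id y)).pow 2).div_const 4)).congr_deriv ?_
    simp
    ring
  have hEnn : ∀ b, a ≤ b → 0 ≤ 2 * deriv ν₀ b ^ 2 - (ν₀ b ^ 2 - b) ^ 2 / 4 := fun b hb =>
    painleve_energy_nonneg hpos hmono.monotone hu hE hu0 hr hb
  have hslope := painleve_slope_le hpos hmono.monotone hv hu ha
  set s := ν₀ a with hs
  set p := deriv ν₀ a with hp
  have hs0 : 0 < s := hpos a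
  have hp0 : 0 ≤ p := hu0 a
  have hconc : ∀ y, a ≤ y → deriv ν₀ y ≤ p := fun y hy =>
    le_of_hasDerivAt_nonpos hy hu (fun x hx _ => by nlinarith [hpos x, hr x hx])
  have htan : ∀ y, a ≤ y → ν₀ y ≤ s + p * (y - a) := by
    intro y hy
    have hl : ∀ y, HasDerivAt (fun y => ν₀ y - p * y) (deriv ν₀ y - p) y := fun y => by
      exact ((hv y).sub ((hasDerivAt_id y).const_mul p)).congr_deriv (by simp)
    have h := le_of_hasDerivAt_nonpos hy hl (fun x hx _ => by linarith [hconc x hx])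
    linarith
  have hbig : (11 : ℝ) / 25 ≤ a := by
    have hG : ∀ y, HasDerivAt (fun y => 2 * deriv ν₀ y ^ 2 - (ν₀ y ^ 2 - y) ^ 2 / 4
        + ((1 - 2 * s * p) / 4 * (y - a) ^ 2 - p ^ 2 / 6 * (y - a) ^ 3))
        ((ν₀ y ^ 2 - y) / 2 + ((1 - 2 * s * p) / 2 * (y - a) - p ^ 2 / 2 * (y - a) ^ 2)) y := by
      intro y
      have hl : HasDerivAt (fun y => y - a) 1 y := (hasDerivAt_id y).sub_const _
      refine ((hE y).add (((hl.pow 2).const_mul _).sub ((hl.pow 3).const_mul _))).congr_deriv ?_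
      simp
      ring
    have h := le_of_hasDerivAt_nonpos (a := a) (b := a + 2) (by linarith) hG (by
      intro y hy _
      have h1 := pow_le_pow_left₀ (hpos y).le (htan y hy) 2
      nlinarith)
    have h2 := hEnn (a + 2) (by linarith)
    simp only [← hs, ← hp, ha] at h
    norm_num at h
    have h3 : p ^ 2 ≤ (4 / 7 * s) ^ 2 := pow_le_pow_left₀ hp0 hslope 2
    have h4 : s * p ≤ s * (4 / 7 * s) := mul_le_mul_of_nonneg_left hslope hs0.le
    nlinarith
  have hright : ∀ y, a ≤ y → 1 / 10 ≤ 3 * ν₀ y ^ 2 - y := by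
    intro y hy
    have hW : ∀ y, HasDerivAt (fun y => y - 3 * ν₀ y ^ 2) (1 - 6 * (ν₀ y * deriv ν₀ y)) y := by
      intro y
      refine ((hasDerivAt_id y).sub (((hv y).pow 2).const_mul 3)).congr_deriv ?_
      simp
      ring
    have h := image_le_of_deriv_right_lt_deriv_boundary (a := a) (b := y)
      (fun x _ => (hW x).continuousAt.continuousWithinAt)
      (fun x _ => (hW x).hasDerivWithinAt)
      (B := fun _ => -(1 / 10)) (B' := fun _ => 0)
      (by simp only [← hs, ha]; linarith) (fun x => hasDerivAt_const x _)
      (by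
        intro x hx hxe
        have hx1 : a ≤ ν₀ x ^ 2 := by
          rw [← ha]
          exact pow_le_pow_left₀ hs0.le (hmono.monotone hx.1) 2
        have hEx := hEnn x hx.1
        have hxd : ν₀ x ^ 2 - x = -(2 * ν₀ x ^ 2 - 1 / 10) := by linarith
        rw [hxd] at hEx
        have hk : (39 / 50 : ℝ) ^ 2 ≤ (2 * ν₀ x ^ 2 - 1 / 10) ^ 2 :=
          pow_le_pow_left₀ (by norm_num) (by linarith) 2
        have hd2 : (39 / 50 : ℝ) ^ 2 / 8 ≤ deriv ν₀ x ^ 2 := by nlinarith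
        have hprod : (11 / 25 : ℝ) * ((39 / 50) ^ 2 / 8) ≤ ν₀ x ^ 2 * deriv ν₀ x ^ 2 :=
          mul_le_mul (hbig.trans hx1) hd2 (by norm_num) (sq_nonneg _)
        have hlt : (1 / 6 : ℝ) < ν₀ x * deriv ν₀ x := by
          refine lt_of_pow_lt_pow_left₀ 2 (mul_nonneg (hpos x).le (hu0 x)) ?_
          rw [mul_pow]
          norm_num at hprod ⊢
          linarith
        linarith)
      (Set.right_mem_Icc.2 hy)
    linarith
  refine ⟨min (min 1 (2 * ν₀ (-1) ^ 2)) (1 / 10), lt_min hlowpos (by norm_num), fun y => ?_⟩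
  rcases le_total y a with h | h
  · exact (min_le_left _ _).trans (hlow y (hleft y h))
  · exact (min_le_right _ _).trans (hright y h)
end

section
/- Let d ∈ {1,2,3}, p ∈ {1,2,3}, and let W : ℝ → ℝ be measurable with W(y) ≥ W_min > 0 for all y. There exists a constant C > 0, independent of ε, such that for every ε > 0 and every u : J_ε → ℝ with ‖u‖_{H¹_ε} < ∞, one has ( ∫_{J_ε} (1−ε^{2/3}y)^{d/2−1} u(y)^{2p} dy )^{1/2} ≤ C ε^{−(p−1)(d−1)/3} ‖u‖_{H¹_ε}^{p}. -/
open Filter Real MeasureTheory Set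

/-- The half line `J_ε = (−∞, ε^{−2/3}]`. -/
noncomputable def Jeps (ε : ℝ) : Set ℝ := Set.Iic (ε ^ (-(2:ℝ)/3))

/-- The weight `1 − ε^{2/3} y`. -/
noncomputable def wt (ε y : ℝ) : ℝ := 1 - ε ^ ((2:ℝ)/3) * y

/-- The `H¹_ε` integrand. -/
noncomputable def H1epsIntegrand (d : ℕ) (ε : ℝ) (W : ℝ → ℝ) (u : ℝ → ℝ) (y : ℝ) : ℝ :=
  4 * (wt ε y) ^ ((d:ℝ)/2) * (deriv u y) ^ 2 + (wt ε y) ^ ((d:ℝ)/2 - 1) * W y * (u y) ^ 2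

/-- Squared weighted `H¹_ε` norm. -/
noncomputable def H1epsSq (d : ℕ) (ε : ℝ) (W : ℝ → ℝ) (u : ℝ → ℝ) : ℝ :=
  ∫ y in Jeps ε, H1epsIntegrand d ε W u y

/-- Cauchy–Schwarz for lower Lebesgue integrals. -/
theorem sq_lintegral_mul_le {X : Type*} [MeasurableSpace X] (μ : Measure X) {f g : X → ENNReal}
    (hf : AEMeasurable f μ) (hg : AEMeasurable g μ) :
    (∫⁻ x, f x * g x ∂μ) ^ 2 ≤ (∫⁻ x, f x ^ 2 ∂μ) * ∫⁻ x, g x ^ 2 ∂μ := by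
  have h := ENNReal.lintegral_mul_le_Lp_mul_Lq μ Real.HolderConjugate.two_two hf hg
  have hsq (a : ENNReal) : (a ^ ((1 : ℝ) / 2)) ^ 2 = a := by
    rw [← ENNReal.rpow_natCast, ← ENNReal.rpow_mul]
    norm_num
  calc (∫⁻ x, f x * g x ∂μ) ^ 2
      ≤ ((∫⁻ x, f x ^ (2 : ℝ) ∂μ) ^ ((1 : ℝ) / 2)
          * (∫⁻ x, g x ^ (2 : ℝ) ∂μ) ^ ((1 : ℝ) / 2)) ^ 2 := by gcongr; exact h
    _ = _ := by simp only [mul_pow, hsq, ENNReal.rpow_two]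

theorem lintegral_Ioo_zero_rpow {s t : ℝ} (hs : -1 < s) (ht : 0 < t) :
    ∫⁻ x in Ioo 0 t, ENNReal.ofReal (x ^ s) = ENNReal.ofReal (t ^ (s + 1) / (s + 1)) := by
  have hint : IntegrableOn (fun x : ℝ => x ^ s) (Ioo 0 t) :=
    ((intervalIntegral.intervalIntegrable_rpow' (a := 0) (b := t) hs).1).mono_set
      Ioo_subset_Ioc_self
  rw [← ofReal_integral_eq_lintegral_ofReal hint
    (by filter_upwards [ae_restrict_mem measurableSet_Ioo] with x hx
        exact rpow_nonneg hx.1.le _),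
    ← integral_Ioc_eq_integral_Ioo, ← intervalIntegral.integral_of_le ht.le,
    integral_rpow (Or.inl hs), zero_rpow (by linarith), sub_zero]

theorem lintegral_rpow_mul_lintegral_Ioi {s : ℝ} (hs : -1 < s) {h : ℝ → ENNReal}
    (hh : Measurable h) :
    ∫⁻ x in Ioi 0, ENNReal.ofReal (x ^ s) * ∫⁻ t in Ioi x, h t
      = ∫⁻ t in Ioi 0, ENNReal.ofReal (t ^ (s + 1) / (s + 1)) * h t := by
  have hm : Measurable (fun z : ℝ × ℝ =>
      ({z : ℝ × ℝ | 0 < z.1 ∧ z.1 < z.2}.indicator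
        (fun z => ENNReal.ofReal (z.1 ^ s) * h z.2) z)) := by
    refine Measurable.indicator (by fun_prop) ?_
    exact (measurableSet_lt measurable_const measurable_fst).inter
      (measurableSet_lt measurable_fst measurable_snd)
  have hswap := lintegral_lintegral_swap (μ := volume) (ν := volume)
    (f := fun x t : ℝ => ({z : ℝ × ℝ | 0 < z.1 ∧ z.1 < z.2}.indicator
        (fun z => ENNReal.ofReal (z.1 ^ s) * h z.2) (x, t))) hm.aemeasurable
  calc ∫⁻ x in Ioi 0, ENNReal.ofReal (x ^ s) * ∫⁻ t in Ioi x, h t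
      = _ := by
        rw [← lintegral_indicator measurableSet_Ioi]
        refine lintegral_congr fun x => ?_
        by_cases hx : 0 < x
        · rw [indicator_of_mem (show x ∈ Ioi (0 : ℝ) from hx), ← lintegral_const_mul _ hh,
            ← lintegral_indicator measurableSet_Ioi]
          refine lintegral_congr fun t => ?_
          simp [indicator_apply, hx]
        · simp [hx]
    _ = _ := hswap
    _ = _ := by
        rw [← lintegral_indicator measurableSet_Ioi]
        refine lintegral_congr fun t => ?_
        by_cases ht : 0 < t
        · rw [indicator_of_mem (show t ∈ Ioi (0 : ℝ) from ht), ← lintegral_Ioo_zero_rpow hs ht,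
            ← lintegral_mul_const _ (by fun_prop), ← lintegral_indicator measurableSet_Ioo]
          refine lintegral_congr fun x => ?_
          simp [indicator_apply]
        · have : ∀ x : ℝ, ¬ (0 < x ∧ x < t) := fun x hx => ht (hx.1.trans hx.2)
          simp [ht, this]

theorem ofReal_abs_le_lintegral_Ioi {g : ℝ → ℝ} (hg : Differentiable ℝ g)
    (hlim : Tendsto g atTop (nhds 0)) (x : ℝ) :
    ENNReal.ofReal |g x| ≤ ∫⁻ t in Ioi x, ENNReal.ofReal |deriv g t| := by
  by_cases htop : ∫⁻ t in Ioi x, ENNReal.ofReal |deriv g t| = ⊤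
  · simp [htop]
  have hint : IntegrableOn (deriv g) (Ioi x) := by
    refine ⟨(measurable_deriv g).aestronglyMeasurable, ?_⟩
    rw [hasFiniteIntegral_iff_norm]
    exact lt_top_iff_ne_top.2 htop
  have h := integral_Ioi_of_hasDerivAt_of_tendsto' (a := x) (f := g) (f' := deriv g)
    (fun y _ => (hg y).hasDerivAt) hint hlim
  have h2 := enorm_integral_le_lintegral_enorm (μ := volume.restrict (Ioi x)) (deriv g)
  rw [h, zero_sub, enorm_neg] at h2
  simpa [← Real.enorm_eq_ofReal_abs] using h2

theorem setLIntegral_Iic_eq_comp_affine {c : ℝ} (hc : 0 < c) (F : ℝ → ENNReal) :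
    ∫⁻ y in Iic (1 / c), F y
      = ENNReal.ofReal (1 / c) * ∫⁻ x in Ioi 0, F ((1 - x) / c) := by
  have himg : (fun x : ℝ => (1 - x) / c) '' Ioi 0 = Iio (1 / c) := by
    ext y
    simp only [mem_image, mem_Ioi, mem_Iio]
    constructor
    · rintro ⟨x, hx, rfl⟩
      gcongr
      linarith
    · intro hy
      refine ⟨1 - c * y, ?_, by field_simp; ring⟩
      rw [lt_div_iff₀ hc] at hy
      linarith
  have h := lintegral_image_eq_lintegral_abs_deriv_mul (s := Ioi (0 : ℝ))
    (f := fun x : ℝ => (1 - x) / c) (f' := fun _ => -1 / c) measurableSet_Ioi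
    (fun x _ => (((hasDerivAt_id x).const_sub 1).div_const c).hasDerivWithinAt)
    (fun x _ y _ hxy => by
      simp only at hxy
      field_simp at hxy
      linarith) F
  rw [himg] at h
  rw [← restrict_Iio_eq_restrict_Iic, h, lintegral_const_mul']
  · rw [abs_div, abs_neg, abs_one, abs_of_pos hc]
  · exact ENNReal.ofReal_ne_top

theorem tendsto_zero_of_weighted_integrableOn {v : ℝ → ℝ} (hv : Differentiable ℝ v)
    (hd : IntegrableOn (fun x => x ^ ((1 : ℝ) / 2) * deriv v x ^ 2) (Ioi 1))
    (hL : IntegrableOn (fun x => x ^ (-(1 : ℝ) / 2) * v x ^ 2) (Ioi 1)) :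
    Tendsto v atTop (nhds 0) := by
  have hder (x : ℝ) : HasDerivAt (fun x => v x ^ 2) (2 * v x * deriv v x) x := by
    simpa using (hv x).hasDerivAt.fun_pow 2
  have hint : IntegrableOn (fun x => 2 * v x * deriv v x) (Ioi 1) := by
    refine Integrable.mono' (hd.add hL)
      (((hv.continuous.measurable.const_mul 2).mul (measurable_deriv v)).aestronglyMeasurable) ?_
    filter_upwards [ae_restrict_mem measurableSet_Ioi] with x hx
    have hx0 : (0 : ℝ) < x := lt_trans one_pos hx
    have h1 : x ^ ((1 : ℝ) / 2) = (x ^ ((1 : ℝ) / 4)) ^ 2 := by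
      rw [← rpow_natCast, ← rpow_mul hx0.le]; norm_num
    have h2 : x ^ (-(1 : ℝ) / 2) = (x ^ (-(1 : ℝ) / 4)) ^ 2 := by
      rw [← rpow_natCast, ← rpow_mul hx0.le]; norm_num
    have h3 : x ^ ((1 : ℝ) / 4) * x ^ (-(1 : ℝ) / 4) = 1 := by
      rw [← rpow_add hx0]; norm_num
    simp only [Pi.add_apply, h1, h2, norm_eq_abs]
    set a := x ^ ((1 : ℝ) / 4)
    set b := x ^ (-(1 : ℝ) / 4)
    have e : 2 * v x * deriv v x = 2 * (b * v x) * (a * deriv v x) := by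
      linear_combination -(2 * v x * deriv v x) * h3
    rw [e, abs_le]
    constructor <;> nlinarith [sq_nonneg (a * deriv v x + b * v x),
      sq_nonneg (a * deriv v x - b * v x)]
  have hlim := tendsto_limUnder_of_hasDerivAt_of_integrableOn_Ioi
    (fun x (_ : x ∈ Ioi (1 : ℝ)) => hder x) hint
  set L := limUnder atTop (fun x => v x ^ 2)
  have hL0 : 0 ≤ L := ge_of_tendsto' hlim fun x => sq_nonneg _
  have hLz : L = 0 := by
    by_contra hne
    have hLpos : 0 < L := lt_of_le_of_ne hL0 (Ne.symm hne)
    refine not_integrableOn_of_tendsto_norm_atTop_of_deriv_isBigO_filter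
      (f := fun x : ℝ => x ^ ((1 : ℝ) / 2)) atTop (Ioi_mem_atTop 1) ?_ ?_ ?_ hL
    · filter_upwards [eventually_gt_atTop 0] with x hx
      exact (Real.hasDerivAt_rpow_const (Or.inl hx.ne')).differentiableAt
    · exact tendsto_norm_atTop_atTop.comp (tendsto_rpow_atTop (by norm_num))
    · refine Asymptotics.IsBigO.of_bound (1 / L) ?_
      filter_upwards [eventually_gt_atTop 0, hlim.eventually (lt_mem_nhds (half_lt_self hLpos))]
        with x hx hxL
      rw [(Real.hasDerivAt_rpow_const (Or.inl hx.ne')).deriv, norm_mul, norm_mul,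
        show (1 : ℝ) / 2 - 1 = -1 / 2 by norm_num, norm_of_nonneg (sq_nonneg (v x)),
        norm_of_nonneg (rpow_nonneg hx.le _), norm_of_nonneg (by norm_num : (0 : ℝ) ≤ 1 / 2)]
      have hp := rpow_nonneg hx.le (-(1 : ℝ) / 2)
      have h12 : 1 / 2 ≤ 1 / L * v x ^ 2 := by
        rw [one_div_mul_eq_div, le_div_iff₀ hLpos]
        linarith
      nlinarith [mul_le_mul_of_nonneg_left h12 hp]
  rw [hLz] at hlim
  have hsqrt := (Real.continuous_sqrt.tendsto 0).comp hlim
  rw [Real.sqrt_zero] at hsqrt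
  rw [tendsto_zero_iff_abs_tendsto_zero]
  exact hsqrt.congr fun x => Real.sqrt_sq_eq_abs (v x)

theorem rpow_mul_abs_le_lintegral {g : ℝ → ℝ} (hg : Differentiable ℝ g)
    (hlim : Tendsto g atTop (nhds 0)) {s : ℝ} (hs : 0 ≤ s) {x : ℝ} (hx : 0 < x) :
    ENNReal.ofReal (x ^ s * |g x|)
      ≤ ∫⁻ t in Ioi 0, ENNReal.ofReal (t ^ s * |deriv g t|) := by
  have hm : Measurable fun t => ENNReal.ofReal |deriv g t| :=
    (measurable_deriv g).abs.ennreal_ofReal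
  calc ENNReal.ofReal (x ^ s * |g x|)
      = ENNReal.ofReal (x ^ s) * ENNReal.ofReal |g x| := ENNReal.ofReal_mul (rpow_nonneg hx.le _)
    _ ≤ ENNReal.ofReal (x ^ s) * ∫⁻ t in Ioi x, ENNReal.ofReal |deriv g t| := by
        gcongr
        exact ofReal_abs_le_lintegral_Ioi hg hlim x
    _ = ∫⁻ t in Ioi x, ENNReal.ofReal (x ^ s) * ENNReal.ofReal |deriv g t| :=
        (lintegral_const_mul _ hm).symm
    _ ≤ ∫⁻ t in Ioi x, ENNReal.ofReal (t ^ s * |deriv g t|) := by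
        refine setLIntegral_mono' measurableSet_Ioi fun t ht => ?_
        rw [← ENNReal.ofReal_mul (rpow_nonneg hx.le _)]
        have : x < t := ht
        gcongr
    _ ≤ _ := lintegral_mono_set (Ioi_subset_Ioi hx.le)

theorem sq_lintegral_rpow_mul_abs_le {f h : ℝ → ℝ} (hf : Measurable f) (hh : Measurable h)
    (k : ℝ) {s r q : ℝ} (hrq : r + q = 2 * s) :
    (∫⁻ t in Ioi 0, ENNReal.ofReal (t ^ s * |k * h t * f t|)) ^ 2
      ≤ ENNReal.ofReal (k ^ 2) * (∫⁻ t in Ioi 0, ENNReal.ofReal (t ^ r * f t ^ 2))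
        * ∫⁻ t in Ioi 0, ENNReal.ofReal (t ^ q * h t ^ 2) := by
  have hsq {t : ℝ} (ht : 0 < t) (c : ℝ) : (t ^ (c / 2)) ^ 2 = t ^ c := by
    rw [← rpow_natCast, ← rpow_mul ht.le]
    norm_num
  calc (∫⁻ t in Ioi 0, ENNReal.ofReal (t ^ s * |k * h t * f t|)) ^ 2
      = (∫⁻ t in Ioi 0, ENNReal.ofReal (|k| * (t ^ (r / 2) * |f t|))
          * ENNReal.ofReal (t ^ (q / 2) * |h t|)) ^ 2 := by
        congr 1
        refine setLIntegral_congr_fun measurableSet_Ioi fun t (ht : 0 < t) => ?_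
        rw [← ENNReal.ofReal_mul (by positivity), abs_mul, abs_mul,
          show s = r / 2 + q / 2 by linarith, rpow_add ht]
        ring_nf
    _ ≤ _ := sq_lintegral_mul_le _ (by fun_prop) (by fun_prop)
    _ = _ := by
        rw [← lintegral_const_mul' _ _ ENNReal.ofReal_ne_top]
        congr 1
        · refine setLIntegral_congr_fun measurableSet_Ioi fun t (ht : 0 < t) => ?_
          rw [← ENNReal.ofReal_pow (by positivity), ← ENNReal.ofReal_mul (by positivity)]
          simp only [mul_pow, sq_abs, hsq ht]
        · refine setLIntegral_congr_fun measurableSet_Ioi fun t (ht : 0 < t) => ?_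
          rw [← ENNReal.ofReal_pow (by positivity)]
          simp only [mul_pow, sq_abs, hsq ht]

/-- The radial Gagliardo–Nirenberg inequality in the plane. -/
theorem lintegral_sq_le_sq_lintegral_sqrt_mul_abs_deriv {g : ℝ → ℝ} (hg : Differentiable ℝ g)
    (hlim : Tendsto g atTop (nhds 0)) :
    ∫⁻ x in Ioi 0, ENNReal.ofReal (g x ^ 2)
      ≤ 2 * (∫⁻ t in Ioi 0, ENNReal.ofReal (t ^ ((1 : ℝ) / 2) * |deriv g t|)) ^ 2 := by
  set D := ∫⁻ t in Ioi 0, ENNReal.ofReal (t ^ ((1 : ℝ) / 2) * |deriv g t|)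
  have hm : Measurable fun t => ENNReal.ofReal |deriv g t| :=
    (measurable_deriv g).abs.ennreal_ofReal
  have hgm : Measurable g := hg.continuous.measurable
  have htail : ∫⁻ x in Ioi 0, ENNReal.ofReal (x ^ (-(1 : ℝ) / 2)) * ENNReal.ofReal |g x|
      ≤ 2 * D := by
    calc _ ≤ ∫⁻ x in Ioi 0, ENNReal.ofReal (x ^ (-(1 : ℝ) / 2))
            * ∫⁻ t in Ioi x, ENNReal.ofReal |deriv g t| := by
          refine setLIntegral_mono' measurableSet_Ioi fun x _ => ?_
          gcongr
          exact ofReal_abs_le_lintegral_Ioi hg hlim x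
      _ = _ := lintegral_rpow_mul_lintegral_Ioi (by norm_num) hm
      _ = 2 * D := by
          rw [← lintegral_const_mul' _ _ (by norm_num)]
          refine setLIntegral_congr_fun measurableSet_Ioi fun t (ht : 0 < t) => ?_
          rw [← ENNReal.ofReal_ofNat, ← ENNReal.ofReal_mul (by positivity),
            ← ENNReal.ofReal_mul (by norm_num)]
          congr 1
          norm_num
          ring
  calc ∫⁻ x in Ioi 0, ENNReal.ofReal (g x ^ 2)
      ≤ ∫⁻ x in Ioi 0, D * (ENNReal.ofReal (x ^ (-(1 : ℝ) / 2)) * ENNReal.ofReal |g x|) := by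
        refine setLIntegral_mono' measurableSet_Ioi fun x (hx : 0 < x) => ?_
        have h1 := rpow_mul_abs_le_lintegral hg hlim (s := 1 / 2) (by norm_num) hx
        refine le_trans (le_of_eq ?_) (mul_le_mul_left h1 _)
        rw [← ENNReal.ofReal_mul (by positivity), ← ENNReal.ofReal_mul (by positivity)]
        have h3 : x ^ ((1 : ℝ) / 2) * x ^ (-(1 : ℝ) / 2) = 1 := by
          rw [← rpow_add hx]; norm_num
        congr 1
        rw [← sq_abs]
        linear_combination -|g x| ^ 2 * h3
    _ = D * ∫⁻ x in Ioi 0, ENNReal.ofReal (x ^ (-(1 : ℝ) / 2)) * ENNReal.ofReal |g x| :=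
        lintegral_const_mul _ (by fun_prop)
    _ ≤ D * (2 * D) := by gcongr
    _ = 2 * D ^ 2 := by ring

theorem ofReal_sq_le_rpow_mul_lintegral {v : ℝ → ℝ} (hv : Differentiable ℝ v)
    (hlim : Tendsto v atTop (nhds 0)) {s : ℝ} (hs : 1 < s) {x : ℝ} (hx : 0 < x) :
    ENNReal.ofReal (v x ^ 2) ≤ ENNReal.ofReal (x ^ (1 - s) / (s - 1))
      * ∫⁻ t in Ioi x, ENNReal.ofReal (t ^ s * deriv v t ^ 2) := by
  have hdm : Measurable (deriv v) := measurable_deriv v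
  have hpow : ∫⁻ t in Ioi x, ENNReal.ofReal (t ^ (-s))
      = ENNReal.ofReal (x ^ (1 - s) / (s - 1)) := by
    rw [← ofReal_integral_eq_lintegral_ofReal (integrableOn_Ioi_rpow_of_lt (by linarith) hx)
      (by filter_upwards [ae_restrict_mem measurableSet_Ioi] with t ht
          exact rpow_nonneg (hx.trans ht).le _),
      integral_Ioi_rpow_of_lt (by linarith) hx, show -s + 1 = 1 - s by ring,
      ← neg_sub s 1, neg_div_neg_eq]
  have hsq {t : ℝ} (ht : 0 < t) (c : ℝ) : (t ^ (c / 2)) ^ 2 = t ^ c := by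
    rw [← rpow_natCast, ← rpow_mul ht.le]
    norm_num
  calc ENNReal.ofReal (v x ^ 2) = ENNReal.ofReal |v x| ^ 2 := by
        rw [← ENNReal.ofReal_pow (abs_nonneg _), sq_abs]
    _ ≤ (∫⁻ t in Ioi x, ENNReal.ofReal |deriv v t|) ^ 2 := by
        gcongr
        exact ofReal_abs_le_lintegral_Ioi hv hlim x
    _ = (∫⁻ t in Ioi x, ENNReal.ofReal (t ^ (-s / 2))
          * ENNReal.ofReal (t ^ (s / 2) * |deriv v t|)) ^ 2 := by
        congr 1
        refine setLIntegral_congr_fun measurableSet_Ioi fun t (ht : x < t) => ?_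
        have ht0 : 0 < t := hx.trans ht
        rw [← ENNReal.ofReal_mul (by positivity), ← mul_assoc, ← rpow_add ht0, neg_div,
          neg_add_cancel, rpow_zero, one_mul]
    _ ≤ _ := sq_lintegral_mul_le _ (by fun_prop) (by fun_prop)
    _ = _ := by
        rw [← hpow]
        congr 1 <;>
        · refine setLIntegral_congr_fun measurableSet_Ioi fun t (ht : x < t) => ?_
          have ht0 : 0 < t := hx.trans ht
          rw [← ENNReal.ofReal_pow (by positivity)]
          simp only [mul_pow, sq_abs, hsq ht0]

/-- The radial Hardy inequality in three dimensions. -/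
theorem lintegral_hardy {v : ℝ → ℝ} (hv : Differentiable ℝ v)
    (hlim : Tendsto v atTop (nhds 0)) :
    ∫⁻ x in Ioi 0, ENNReal.ofReal (x ^ (-(1 : ℝ) / 2) * v x ^ 2)
      ≤ 16 * ∫⁻ t in Ioi 0, ENNReal.ofReal (t ^ ((3 : ℝ) / 2) * deriv v t ^ 2) := by
  have hdm : Measurable (deriv v) := measurable_deriv v
  calc ∫⁻ x in Ioi 0, ENNReal.ofReal (x ^ (-(1 : ℝ) / 2) * v x ^ 2)
      ≤ ∫⁻ x in Ioi 0, 4 * (ENNReal.ofReal (x ^ (-(3 : ℝ) / 4))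
          * ∫⁻ t in Ioi x, ENNReal.ofReal (t ^ ((5 : ℝ) / 4) * deriv v t ^ 2)) := by
        refine setLIntegral_mono' measurableSet_Ioi fun x (hx : 0 < x) => ?_
        have h := ofReal_sq_le_rpow_mul_lintegral hv hlim (s := 5 / 4) (by norm_num) hx
        rw [ENNReal.ofReal_mul (by positivity)]
        refine (mul_le_mul_right h _).trans (le_of_eq ?_)
        rw [← mul_assoc, ← mul_assoc, ← ENNReal.ofReal_mul (by positivity),
          ← ENNReal.ofReal_ofNat, ← ENNReal.ofReal_mul (by norm_num), ← mul_div_assoc,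
          ← rpow_add hx]
        congr 2
        norm_num
        ring_nf
    _ = 4 * ∫⁻ x in Ioi 0, ENNReal.ofReal (x ^ (-(3 : ℝ) / 4))
          * ∫⁻ t in Ioi x, ENNReal.ofReal (t ^ ((5 : ℝ) / 4) * deriv v t ^ 2) :=
        lintegral_const_mul' _ _ (by norm_num)
    _ = 4 * _ := by rw [lintegral_rpow_mul_lintegral_Ioi (by norm_num) (by fun_prop)]
    _ = _ := by
        rw [← lintegral_const_mul' _ _ (by norm_num), ← lintegral_const_mul' _ _ (by norm_num)]
        refine setLIntegral_congr_fun measurableSet_Ioi fun t (ht : 0 < t) => ?_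
        rw [← ENNReal.ofReal_ofNat 4, ← ENNReal.ofReal_ofNat 16,
          ← ENNReal.ofReal_mul (by positivity), ← ENNReal.ofReal_mul (by norm_num),
          ← ENNReal.ofReal_mul (by norm_num),
          show (3 : ℝ) / 2 = (-3 / 4 + 1) + 5 / 4 by norm_num, rpow_add ht (-3 / 4 + 1) (5 / 4)]
        congr 1
        norm_num
        ring

theorem lintegral_pow_six_le_of_dim_one {v : ℝ → ℝ} (hv : Differentiable ℝ v)
    (hlim : Tendsto v atTop (nhds 0)) :
    ∫⁻ x in Ioi 0, ENNReal.ofReal (x ^ (-(1 : ℝ) / 2) * v x ^ 6)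
      ≤ 4 * (∫⁻ x in Ioi 0, ENNReal.ofReal (x ^ ((1 : ℝ) / 2) * deriv v x ^ 2))
        * (∫⁻ x in Ioi 0, ENNReal.ofReal (x ^ (-(1 : ℝ) / 2) * v x ^ 2)) ^ 2 := by
  have hvm : Measurable v := hv.continuous.measurable
  have hder : deriv (fun x => v x ^ 2) = fun x => 2 * v x * deriv v x := by
    ext x
    simpa using ((hv x).hasDerivAt.fun_pow 2).deriv
  have hlim2 : Tendsto (fun x => v x ^ 2) atTop (nhds 0) := by simpa using hlim.pow 2
  have hCS := sq_lintegral_rpow_mul_abs_le (measurable_deriv v) hvm 2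
    (s := 0) (r := 1 / 2) (q := -1 / 2) (by norm_num)
  set D := ∫⁻ t in Ioi 0, ENNReal.ofReal (t ^ (0 : ℝ) * |2 * v t * deriv v t|) with hD
  have hpt : ∀ x ∈ Ioi (0 : ℝ), ENNReal.ofReal (v x ^ 2) ≤ D := fun x hx => by
    have h := rpow_mul_abs_le_lintegral (hv.fun_pow 2) hlim2 le_rfl hx
    rw [hder] at h
    simpa [hD] using h
  calc ∫⁻ x in Ioi 0, ENNReal.ofReal (x ^ (-(1 : ℝ) / 2) * v x ^ 6)
      ≤ ∫⁻ x in Ioi 0, D ^ 2 * ENNReal.ofReal (x ^ (-(1 : ℝ) / 2) * v x ^ 2) := by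
        refine setLIntegral_mono' measurableSet_Ioi fun x hx => ?_
        refine le_trans (le_of_eq ?_) (mul_le_mul_left (pow_le_pow_left' (hpt x hx) 2) _)
        rw [← ENNReal.ofReal_pow (by positivity), ← ENNReal.ofReal_mul (by positivity)]
        ring_nf
    _ = D ^ 2 * _ := lintegral_const_mul _ (by fun_prop)
    _ ≤ _ := mul_le_mul_left hCS _
    _ = _ := by
        rw [show ENNReal.ofReal ((2 : ℝ) ^ 2) = 4 by norm_num]
        ring

theorem lintegral_pow_six_le_of_dim_two {v : ℝ → ℝ} (hv : Differentiable ℝ v)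
    (hlim : Tendsto v atTop (nhds 0)) :
    ∫⁻ x in Ioi 0, ENNReal.ofReal (v x ^ 6)
      ≤ 144 * (∫⁻ x in Ioi 0, ENNReal.ofReal (x ^ (1 : ℝ) * deriv v x ^ 2)) ^ 2
        * ∫⁻ x in Ioi 0, ENNReal.ofReal (x ^ (0 : ℝ) * v x ^ 2) := by
  have hvm : Measurable v := hv.continuous.measurable
  have hder2 : deriv (fun x => v x ^ 2) = fun x => 2 * v x * deriv v x := by
    ext x
    simpa using ((hv x).hasDerivAt.fun_pow 2).deriv
  have hder3 : deriv (fun x => v x ^ 3) = fun x => 3 * v x ^ 2 * deriv v x := by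
    ext x
    simpa using ((hv x).hasDerivAt.fun_pow 3).deriv
  have hlim2 : Tendsto (fun x => v x ^ 2) atTop (nhds 0) := by simpa using hlim.pow 2
  have hlim3 : Tendsto (fun x => v x ^ 3) atTop (nhds 0) := by simpa using hlim.pow 3
  have hCS2 := sq_lintegral_rpow_mul_abs_le (measurable_deriv v) hvm 2
    (s := 1 / 2) (r := 1) (q := 0) (by norm_num)
  have hCS3 := sq_lintegral_rpow_mul_abs_le (measurable_deriv v) (hvm.pow_const 2) 3
    (s := 1 / 2) (r := 1) (q := 0) (by norm_num)
  have h2 := lintegral_sq_le_sq_lintegral_sqrt_mul_abs_deriv (hv.fun_pow 2) hlim2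
  have h3 := lintegral_sq_le_sq_lintegral_sqrt_mul_abs_deriv (hv.fun_pow 3) hlim3
  rw [hder2] at h2
  rw [hder3] at h3
  set a := ∫⁻ x in Ioi 0, ENNReal.ofReal (x ^ (1 : ℝ) * deriv v x ^ 2)
  set b := ∫⁻ x in Ioi 0, ENNReal.ofReal (x ^ (0 : ℝ) * v x ^ 2)
  simp only [← pow_mul, rpow_zero, one_mul] at h2 h3 hCS3
  rw [show ENNReal.ofReal ((2 : ℝ) ^ 2) = 4 by norm_num] at hCS2
  rw [show ENNReal.ofReal ((3 : ℝ) ^ 2) = 9 by norm_num] at hCS3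
  calc _ ≤ _ := h3
    _ ≤ 2 * (9 * a * (2 * (4 * a * b))) := by
        gcongr
        refine hCS3.trans ?_
        gcongr
        refine h2.trans ?_
        gcongr
    _ = _ := by ring

theorem lintegral_pow_six_le_of_dim_three {v : ℝ → ℝ} (hv : Differentiable ℝ v)
    (hlim : Tendsto v atTop (nhds 0)) :
    ∫⁻ x in Ioi 0, ENNReal.ofReal (x ^ ((1 : ℝ) / 2) * v x ^ 6)
      ≤ 64 * (∫⁻ x in Ioi 0, ENNReal.ofReal (x ^ ((3 : ℝ) / 2) * deriv v x ^ 2)) ^ 3 := by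
  have hvm : Measurable v := hv.continuous.measurable
  set a := ∫⁻ x in Ioi 0, ENNReal.ofReal (x ^ ((3 : ℝ) / 2) * deriv v x ^ 2)
  have hpt : ∀ x ∈ Ioi (0 : ℝ), ENNReal.ofReal (x ^ ((1 : ℝ) / 2) * v x ^ 2) ≤ 2 * a :=
    fun x (hx : 0 < x) => by
    have h := ofReal_sq_le_rpow_mul_lintegral hv hlim (s := 3 / 2) (by norm_num) hx
    calc _ = ENNReal.ofReal (x ^ ((1 : ℝ) / 2)) * ENNReal.ofReal (v x ^ 2) :=
          ENNReal.ofReal_mul (by positivity)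
      _ ≤ _ := mul_le_mul_right h _
      _ = 2 * ∫⁻ t in Ioi x, ENNReal.ofReal (t ^ ((3 : ℝ) / 2) * deriv v t ^ 2) := by
          rw [← mul_assoc, ← ENNReal.ofReal_mul (by positivity), ← mul_div_assoc, ← rpow_add hx,
            ← ENNReal.ofReal_ofNat 2]
          norm_num
      _ ≤ _ := by
          gcongr
          exact lintegral_mono_set (Ioi_subset_Ioi hx.le)
  calc ∫⁻ x in Ioi 0, ENNReal.ofReal (x ^ ((1 : ℝ) / 2) * v x ^ 6)
      ≤ ∫⁻ x in Ioi 0, (2 * a) ^ 2 * ENNReal.ofReal (x ^ (-(1 : ℝ) / 2) * v x ^ 2) := by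
        refine setLIntegral_mono' measurableSet_Ioi fun x (hx : 0 < x) => ?_
        refine le_trans (le_of_eq ?_) (mul_le_mul_left (pow_le_pow_left' (hpt x hx) 2) _)
        rw [← ENNReal.ofReal_pow (by positivity), ← ENNReal.ofReal_mul (by positivity)]
        have h3 : x ^ ((1 : ℝ) / 2) * x ^ (-(1 : ℝ) / 2) = 1 := by
          rw [← rpow_add hx]; norm_num
        congr 1
        linear_combination -(x ^ ((1 : ℝ) / 2) * v x ^ 6) * h3
    _ = (2 * a) ^ 2 * _ := lintegral_const_mul _ (by fun_prop)
    _ ≤ (2 * a) ^ 2 * (16 * a) := by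
        gcongr
        exact lintegral_hardy hv hlim
    _ = _ := by ring

/-- The radial Gagliardo–Nirenberg inequality for the sixth power in dimension at most three,
in the variable given by the square of the radius. -/
theorem lintegral_rpow_mul_pow_six_le {d : ℕ} (hd : d = 1 ∨ d = 2 ∨ d = 3) {v : ℝ → ℝ}
    (hv : Differentiable ℝ v)
    (ha : ∫⁻ x in Ioi 0, ENNReal.ofReal (x ^ ((d : ℝ) / 2) * deriv v x ^ 2) ≠ ⊤)
    (hb : ∫⁻ x in Ioi 0, ENNReal.ofReal (x ^ ((d : ℝ) / 2 - 1) * v x ^ 2) ≠ ⊤) :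
    ∫⁻ x in Ioi 0, ENNReal.ofReal (x ^ ((d : ℝ) / 2 - 1) * v x ^ 6)
      ≤ 144 * (∫⁻ x in Ioi 0, ENNReal.ofReal (x ^ ((d : ℝ) / 2) * deriv v x ^ 2)) ^ d
        * (∫⁻ x in Ioi 0, ENNReal.ofReal (x ^ ((d : ℝ) / 2 - 1) * v x ^ 2)) ^ (3 - d) := by
  have hvm : Measurable v := hv.continuous.measurable
  have hdm : Measurable (deriv v) := measurable_deriv v
  have hd1 : (1 : ℝ) ≤ d := by rcases hd with rfl | rfl | rfl <;> norm_num
  have hint {s r : ℝ} (hsr : s ≤ r) {f : ℝ → ℝ} (hf : Measurable f)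
      (hfin : ∫⁻ x in Ioi 0, ENNReal.ofReal (x ^ r * f x ^ 2) ≠ ⊤) :
      IntegrableOn (fun x => x ^ s * f x ^ 2) (Ioi 1) := by
    refine ⟨(by fun_prop : Measurable _).aestronglyMeasurable, ?_⟩
    rw [hasFiniteIntegral_iff_norm]
    refine lt_of_le_of_lt ?_ (lt_top_iff_ne_top.2 hfin)
    refine (setLIntegral_mono' measurableSet_Ioi fun x (hx : 1 < x) => ?_).trans
      (lintegral_mono_set (Ioi_subset_Ioi zero_le_one))
    rw [norm_of_nonneg (by positivity)]
    gcongr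
    exact hx.le
  have hlim := tendsto_zero_of_weighted_integrableOn hv (hint (by linarith) hdm ha)
    (hint (by linarith) hvm hb)
  rcases hd with rfl | rfl | rfl
  · have h := lintegral_pow_six_le_of_dim_one hv hlim
    norm_num at h ⊢
    refine h.trans ?_
    gcongr
    norm_num
  · have h := lintegral_pow_six_le_of_dim_two hv hlim
    norm_num at h ⊢
    exact h
  · have h := lintegral_pow_six_le_of_dim_three hv hlim
    norm_num at h ⊢
    refine h.trans ?_
    gcongr
    norm_num

theorem lintegral_affine_weight_pow_six_le {d : ℕ} (hd : d = 1 ∨ d = 2 ∨ d = 3) {c S : ℝ}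
    (hc : 0 < c) (hS : 0 ≤ S) {u : ℝ → ℝ} (hu : Differentiable ℝ u)
    (hA : ∫⁻ y in Iic (1 / c), ENNReal.ofReal ((1 - c * y) ^ ((d : ℝ) / 2) * deriv u y ^ 2)
      ≤ ENNReal.ofReal S)
    (hB : ∫⁻ y in Iic (1 / c), ENNReal.ofReal ((1 - c * y) ^ ((d : ℝ) / 2 - 1) * u y ^ 2)
      ≤ ENNReal.ofReal S) :
    ∫⁻ y in Iic (1 / c), ENNReal.ofReal ((1 - c * y) ^ ((d : ℝ) / 2 - 1) * u y ^ 6)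
      ≤ ENNReal.ofReal (144 * S ^ 3 * c⁻¹ ^ (2 * (d - 1))) := by
  have hw (x : ℝ) : 1 - c * ((1 - x) / c) = x := by field_simp; ring
  rw [setLIntegral_Iic_eq_comp_affine hc] at hA hB ⊢
  simp only [hw] at hA hB ⊢
  set v : ℝ → ℝ := fun x => u ((1 - x) / c)
  have hv : Differentiable ℝ v := by fun_prop
  have hdv (x : ℝ) : deriv v x = -(1 / c) * deriv u ((1 - x) / c) := by
    have h := (hu ((1 - x) / c)).hasDerivAt.comp x
      (((hasDerivAt_id x).const_sub 1).div_const c)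
    rw [show deriv v x = _ from h.deriv]
    ring
  have hinv : ENNReal.ofReal c * ENNReal.ofReal (1 / c) = 1 := by
    rw [← ENNReal.ofReal_mul hc.le, mul_one_div_cancel hc.ne', ENNReal.ofReal_one]
  have ha : ∫⁻ x in Ioi 0, ENNReal.ofReal (x ^ ((d : ℝ) / 2) * deriv v x ^ 2)
      ≤ ENNReal.ofReal (S / c) := by
    calc _ = ∫⁻ x in Ioi 0, ENNReal.ofReal (1 / c) * (ENNReal.ofReal (1 / c) *
            ENNReal.ofReal (x ^ ((d : ℝ) / 2) * deriv u ((1 - x) / c) ^ 2)) := by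
          refine lintegral_congr fun x => ?_
          rw [← ENNReal.ofReal_mul (by positivity), ← ENNReal.ofReal_mul (by positivity), hdv]
          ring_nf
      _ = ENNReal.ofReal (1 / c) * (ENNReal.ofReal (1 / c) * ∫⁻ x in Ioi 0,
            ENNReal.ofReal (x ^ ((d : ℝ) / 2) * deriv u ((1 - x) / c) ^ 2)) := by
          rw [lintegral_const_mul' _ _ ENNReal.ofReal_ne_top,
            lintegral_const_mul' _ _ ENNReal.ofReal_ne_top]
      _ ≤ ENNReal.ofReal (1 / c) * ENNReal.ofReal S := by gcongr
      _ = _ := by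
          rw [← ENNReal.ofReal_mul (by positivity)]
          ring_nf
  have hb : ∫⁻ x in Ioi 0, ENNReal.ofReal (x ^ ((d : ℝ) / 2 - 1) * v x ^ 2)
      ≤ ENNReal.ofReal (c * S) := by
    rw [ENNReal.ofReal_mul hc.le]
    refine le_trans (le_of_eq ?_) (mul_le_mul_right hB _)
    rw [← mul_assoc, hinv, one_mul]
  have h := lintegral_rpow_mul_pow_six_le hd hv (ha.trans_lt ENNReal.ofReal_lt_top).ne
    (hb.trans_lt ENNReal.ofReal_lt_top).ne
  calc _ ≤ _ := mul_le_mul_right h _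
    _ ≤ ENNReal.ofReal (1 / c) * (ENNReal.ofReal 144 * ENNReal.ofReal (S / c) ^ d
          * ENNReal.ofReal (c * S) ^ (3 - d)) := by
        rw [ENNReal.ofReal_ofNat]
        gcongr
    _ = _ := by
        rw [← ENNReal.ofReal_pow (by positivity), ← ENNReal.ofReal_pow (by positivity),
          ← ENNReal.ofReal_mul (by norm_num), ← ENNReal.ofReal_mul (by positivity),
          ← ENNReal.ofReal_mul (by positivity)]
        congr 1
        rcases hd with rfl | rfl | rfl <;> norm_num <;> field_simp

theorem lintegral_affine_weight_pow_le {d : ℕ} (hd : d = 1 ∨ d = 2 ∨ d = 3) {p : ℕ}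
    (hp : p = 1 ∨ p = 2 ∨ p = 3) {c S : ℝ} (hc : 0 < c) (hS : 0 ≤ S) {u : ℝ → ℝ}
    (hu : Differentiable ℝ u)
    (hA : ∫⁻ y in Iic (1 / c), ENNReal.ofReal ((1 - c * y) ^ ((d : ℝ) / 2) * deriv u y ^ 2)
      ≤ ENNReal.ofReal S)
    (hB : ∫⁻ y in Iic (1 / c), ENNReal.ofReal ((1 - c * y) ^ ((d : ℝ) / 2 - 1) * u y ^ 2)
      ≤ ENNReal.ofReal S) :
    ∫⁻ y in Iic (1 / c), ENNReal.ofReal ((1 - c * y) ^ ((d : ℝ) / 2 - 1) * u y ^ (2 * p))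
      ≤ ENNReal.ofReal ((12 * S) ^ p * c⁻¹ ^ ((p - 1) * (d - 1))) := by
  have h6 := lintegral_affine_weight_pow_six_le hd hc hS hu hA hB
  have hum : Measurable u := hu.continuous.measurable
  have hw {y : ℝ} (hy : y ∈ Iic (1 / c)) : 0 ≤ 1 - c * y := by
    have hy' : y ≤ 1 / c := hy
    rw [le_div_iff₀ hc] at hy'
    linarith
  rcases hp with rfl | rfl | rfl
  · refine hB.trans (ENNReal.ofReal_le_ofReal ?_)
    simp only [tsub_self, zero_mul, pow_zero, mul_one, pow_one]
    linarith
  · rw [← ENNReal.pow_le_pow_left_iff two_ne_zero]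
    calc (∫⁻ y in Iic (1 / c), ENNReal.ofReal ((1 - c * y) ^ ((d : ℝ) / 2 - 1) * u y ^ (2 * 2))) ^ 2
        = (∫⁻ y in Iic (1 / c),
            ENNReal.ofReal (√((1 - c * y) ^ ((d : ℝ) / 2 - 1)) * |u y|)
            * ENNReal.ofReal (√((1 - c * y) ^ ((d : ℝ) / 2 - 1)) * |u y| ^ 3)) ^ 2 := by
          congr 1
          refine setLIntegral_congr_fun measurableSet_Iic fun y hy => ?_
          rw [← ENNReal.ofReal_mul (by positivity)]
          congr 1
          have h1 := Real.sq_sqrt (rpow_nonneg (hw hy) ((d : ℝ) / 2 - 1))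
          have h2 : u y ^ (2 * 2) = |u y| ^ 4 := (Even.pow_abs (by decide) _).symm
          rw [h2]
          linear_combination -|u y| ^ 4 * h1
      _ ≤ _ := sq_lintegral_mul_le _ (by fun_prop) (by fun_prop)
      _ = (∫⁻ y in Iic (1 / c), ENNReal.ofReal ((1 - c * y) ^ ((d : ℝ) / 2 - 1) * u y ^ 2))
          * ∫⁻ y in Iic (1 / c), ENNReal.ofReal ((1 - c * y) ^ ((d : ℝ) / 2 - 1) * u y ^ 6) := by
          congr 1 <;>
          · refine setLIntegral_congr_fun measurableSet_Iic fun y hy => ?_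
            rw [← ENNReal.ofReal_pow (by positivity), mul_pow,
              Real.sq_sqrt (rpow_nonneg (hw hy) _)]
            simp only [← pow_mul, Nat.reduceMul, Even.pow_abs (by decide : Even 6), sq_abs]
      _ ≤ _ := mul_le_mul' hB h6
      _ ≤ _ := by
          rw [← ENNReal.ofReal_mul hS, ← ENNReal.ofReal_pow (by positivity)]
          refine ENNReal.ofReal_le_ofReal ?_
          have h0 : 0 ≤ S ^ 4 * c⁻¹ ^ (2 * (d - 1)) := by positivity
          rw [show (2 - 1) * (d - 1) = d - 1 by omega, mul_pow, ← pow_mul c⁻¹, mul_comm (d - 1) 2]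
          nlinarith
  · refine h6.trans (ENNReal.ofReal_le_ofReal ?_)
    rw [show (3 - 1) * (d - 1) = 2 * (d - 1) by omega]
    gcongr
    nlinarith [pow_nonneg hS 3]

/-- Lemma `emb`. For `p = 1,2,3` there is a constant `C > 0` independent of
`ε` such that for every `ε > 0` and every `u ∈ H¹_ε`, `u^p ∈ L²_ε` with
`‖u^p‖_ε ≤ C ε^{−(p−1)(d−1)/3} ‖u‖_{H¹_ε}^p`. -/
theorem weighted_sobolev_embedding
    (d : ℕ) (hd : d = 1 ∨ d = 2 ∨ d = 3)
    (p : ℕ) (hp : p = 1 ∨ p = 2 ∨ p = 3)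
    (W : ℝ → ℝ) (hWmeas : Measurable W)
    (Wmin : ℝ) (hWmin : 0 < Wmin) (hWlow : ∀ y : ℝ, Wmin ≤ W y) :
    ∃ C > (0:ℝ), ∀ ε : ℝ, 0 < ε → ∀ u : ℝ → ℝ, Differentiable ℝ u →
      MeasureTheory.IntegrableOn (H1epsIntegrand d ε W u) (Jeps ε) →
      (∫⁻ y in Jeps ε, ENNReal.ofReal ((wt ε y) ^ ((d:ℝ)/2 - 1) * (u y) ^ (2 * p)))
          ^ ((1:ℝ)/2)
        ≤ ENNReal.ofReal (C * ε ^ (-(((p:ℝ) - 1) * ((d:ℝ) - 1)) / 3) *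
            (Real.sqrt (H1epsSq d ε W u)) ^ p) := by
  set M : ℝ := 1 + 1 / Wmin
  have hM : 1 ≤ M := le_add_of_nonneg_right (by positivity)
  refine ⟨(12 * M) ^ 2, by positivity, fun ε hε u hu hint => ?_⟩
  set c : ℝ := ε ^ ((2 : ℝ) / 3) with hc_def
  have hc : 0 < c := rpow_pos_of_pos hε _
  have hJ : Jeps ε = Iic (1 / c) := by
    rw [Jeps, hc_def, one_div, ← rpow_neg hε.le, neg_div]
  have hw {y : ℝ} (hy : y ∈ Iic (1 / c)) : 0 ≤ 1 - c * y := by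
    have hy' : y ≤ 1 / c := hy
    rw [le_div_iff₀ hc] at hy'
    linarith
  set N := H1epsSq d ε W u with hN_def
  have hterm {y : ℝ} (hy : y ∈ Iic (1 / c)) :
      0 ≤ (1 - c * y) ^ ((d : ℝ) / 2) * deriv u y ^ 2 ∧
      0 ≤ (1 - c * y) ^ ((d : ℝ) / 2 - 1) * u y ^ 2 :=
    ⟨mul_nonneg (rpow_nonneg (hw hy) _) (sq_nonneg _),
      mul_nonneg (rpow_nonneg (hw hy) _) (sq_nonneg _)⟩
  have hlow {y : ℝ} (hy : y ∈ Iic (1 / c)) :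
      4 * ((1 - c * y) ^ ((d : ℝ) / 2) * deriv u y ^ 2)
        + Wmin * ((1 - c * y) ^ ((d : ℝ) / 2 - 1) * u y ^ 2) ≤ H1epsIntegrand d ε W u y := by
    rw [H1epsIntegrand, wt, ← hc_def]
    nlinarith [mul_le_mul_of_nonneg_right (hWlow y) (hterm hy).2]
  have hpos {y : ℝ} (hy : y ∈ Iic (1 / c)) : 0 ≤ H1epsIntegrand d ε W u y := by
    have := hterm hy
    exact le_trans (by nlinarith [mul_nonneg hWmin.le this.2]) (hlow hy)
  rw [hJ] at hint ⊢
  have hN : ENNReal.ofReal N = ∫⁻ y in Iic (1 / c), ENNReal.ofReal (H1epsIntegrand d ε W u y) := by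
    rw [hN_def, H1epsSq, hJ]
    refine ofReal_integral_eq_lintegral_ofReal hint ?_
    filter_upwards [ae_restrict_mem measurableSet_Iic] with y hy using hpos hy
  have hN0 : 0 ≤ N := by
    rw [hN_def, H1epsSq, hJ]
    exact setIntegral_nonneg measurableSet_Iic fun y hy => hpos hy
  have hdom {F : ℝ → ℝ} (hF : ∀ y ∈ Iic (1 / c), F y ≤ M * H1epsIntegrand d ε W u y) :
      ∫⁻ y in Iic (1 / c), ENNReal.ofReal (F y) ≤ ENNReal.ofReal (M * N) := by
    rw [ENNReal.ofReal_mul (by positivity), hN, ← lintegral_const_mul' _ _ ENNReal.ofReal_ne_top]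
    refine setLIntegral_mono' measurableSet_Iic fun y hy => ?_
    rw [← ENNReal.ofReal_mul (by positivity)]
    exact ENNReal.ofReal_le_ofReal (hF y hy)
  have hA := hdom (F := fun y => (1 - c * y) ^ ((d : ℝ) / 2) * deriv u y ^ 2) fun y hy => by
    have h1 := hterm hy
    have h2 := hlow hy
    have h3 := hpos hy
    nlinarith [mul_nonneg hWmin.le h1.2, mul_nonneg (sub_nonneg.2 hM) h3]
  have hB := hdom (F := fun y => (1 - c * y) ^ ((d : ℝ) / 2 - 1) * u y ^ 2) fun y hy => by
    have h1 := hterm hy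
    have h2 := hlow hy
    have h3 := hpos hy
    have h4 : (1 - c * y) ^ ((d : ℝ) / 2 - 1) * u y ^ 2
        ≤ 1 / Wmin * H1epsIntegrand d ε W u y := by
      rw [one_div_mul_eq_div, le_div_iff₀ hWmin]
      linarith
    linarith [show M * H1epsIntegrand d ε W u y = H1epsIntegrand d ε W u y
      + 1 / Wmin * H1epsIntegrand d ε W u y by ring]
  have hmain := lintegral_affine_weight_pow_le hd hp hc (by positivity) hu hA hB
  simp only [wt, ← hc_def]
  set R := (12 * M) ^ 2 * ε ^ (-(((p:ℝ) - 1) * ((d:ℝ) - 1)) / 3) * √N ^ p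
  have hRsq : (12 * (M * N)) ^ p * c⁻¹ ^ ((p - 1) * (d - 1)) ≤ R ^ 2 := by
    have hp1 : 1 ≤ p := by omega
    have hd1 : 1 ≤ d := by omega
    have he : c⁻¹ ^ ((p - 1) * (d - 1))
        = (ε ^ (-(((p:ℝ) - 1) * ((d:ℝ) - 1)) / 3)) ^ 2 := by
      rw [hc_def, ← rpow_neg hε.le, ← rpow_natCast, ← rpow_mul hε.le, ← rpow_natCast,
        ← rpow_mul hε.le]
      push_cast [hp1, hd1]
      ring_nf
    have hs : (√N ^ p) ^ 2 = N ^ p := by rw [pow_right_comm, Real.sq_sqrt hN0]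
    have hk : (12 * M) ^ p ≤ (12 * M) ^ 4 := pow_le_pow_right₀ (by linarith) (by omega)
    have hR2 : R ^ 2 = (12 * M) ^ 4 * N ^ p * c⁻¹ ^ ((p - 1) * (d - 1)) := by
      rw [he, ← hs]
      ring
    rw [hR2, ← mul_assoc, mul_pow]
    gcongr
  have hR : 0 ≤ R := by positivity
  calc _ ≤ (ENNReal.ofReal R ^ 2) ^ ((1 : ℝ) / 2) := by
        gcongr
        rw [← ENNReal.ofReal_pow hR]
        exact hmain.trans (ENNReal.ofReal_le_ofReal hRsq)
    _ = ENNReal.ofReal R := by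
        rw [← ENNReal.rpow_natCast, ← ENNReal.rpow_mul]
        norm_num
end

section
/- Let d ≥ 1 be an integer and let W₀ : ℝ → ℝ be continuous with C₁(1+|y|) ≤ W₀(y) ≤ C₂(1+|y|) for all y ∈ ℝ, for some C₁, C₂ > 0. For ε > 0 set U_ε(z) = W₀(ε^{−2/3} − ε^{2/3}|z|²) for z ∈ ℝ^d. Then there exist ε₀ > 0 and C > 0 such that for every ε ∈ (0, ε₀), every z₀ ∈ ℝ^d and every r > 0, max_{z ∈ closed ball B(z₀,r)} U_ε(z) ≤ (C / vol(B(z₀,r))) ∫_{B(z₀,r)} U_ε(z) dz. -/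
open Filter Real MeasureTheory Metric

/-- The integral of a nonnegative function over a convex set, precomposed with the contraction of
ratio `t` towards a point of the set, is at most `t ^ (-dim E)` times the original integral. -/
theorem setIntegral_comp_contraction_le {E : Type*} [NormedAddCommGroup E] [NormedSpace ℝ E]
    [FiniteDimensional ℝ E] [MeasurableSpace E] [BorelSpace E] (μ : Measure E)
    [μ.IsAddHaarMeasure] {s : Set E} (hs : Convex ℝ s) (hsm : MeasurableSet s) {g : E → ℝ}
    (hg : ∀ x, 0 ≤ g x) (hgi : IntegrableOn g s μ) {z : E} (hz : z ∈ s) {t : ℝ} (ht : 0 < t)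
    (ht1 : t ≤ 1) :
    ∫ w in s, g (z + t • (w - z)) ∂μ ≤ (t ^ Module.finrank ℝ E)⁻¹ * ∫ w in s, g w ∂μ := by
  have hF : Integrable (s.indicator g) μ := (integrable_indicator_iff hsm).2 hgi
  have hshift : ∀ w : E, z + t • (w - z) = (z - t • z) + t • w := by
    intro w; rw [smul_sub]; abel
  have hint : Integrable (fun w => s.indicator g (z + t • (w - z))) μ := by
    simp only [hshift]
    exact (hF.comp_add_left (z - t • z)).comp_smul ht.ne'
  calc ∫ w in s, g (z + t • (w - z)) ∂μ
      = ∫ w, s.indicator (fun w => g (z + t • (w - z))) w ∂μ := (integral_indicator hsm).symm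
    _ ≤ ∫ w, s.indicator g (z + t • (w - z)) ∂μ := by
        refine integral_mono_of_nonneg
          (Eventually.of_forall fun w => Set.indicator_nonneg (fun _ _ => hg _) w) hint
          (Eventually.of_forall fun w => ?_)
        by_cases hw : w ∈ s
        · have : z + t • (w - z) ∈ s := hs.add_smul_sub_mem hz hw ⟨ht.le, ht1⟩
          simp [hw, this]
        · simpa [hw] using Set.indicator_nonneg (fun x _ => hg x) (z + t • (w - z))
    _ = (t ^ Module.finrank ℝ E)⁻¹ * ∫ w in s, g w ∂μ := by
        simp only [hshift]
        rw [Measure.integral_comp_smul μ (fun w => s.indicator g ((z - t • z) + w)) t,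
          integral_add_left_eq_self, integral_indicator hsm, smul_eq_mul, abs_of_pos (by positivity)]

/-- A function `a - b ‖·‖²` is quadratic along lines, so its third differences vanish. -/
theorem sub_mul_norm_sq_eq_of_third_difference {E : Type*} [NormedAddCommGroup E]
    [InnerProductSpace ℝ E] (a b : ℝ) (z w : E) :
    a - b * ‖z‖ ^ 2 = 3 * (a - b * ‖z + (1 / 3 : ℝ) • (w - z)‖ ^ 2)
      - 3 * (a - b * ‖z + (2 / 3 : ℝ) • (w - z)‖ ^ 2) + (a - b * ‖w‖ ^ 2) := by
  obtain ⟨h, rfl⟩ : ∃ h, w = z + h := ⟨w - z, by abel⟩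
  simp only [add_sub_cancel_left, norm_add_sq_real, norm_smul, inner_smul_right, mul_pow,
    Real.norm_eq_abs, sq_abs]
  ring

/-- reverse-Hölder estimate, proof of Lemma `shen`. Under two-sided linear
growth bounds on `W₀`, the rescaled potential `U_ε(z) = W₀(ε^{−2/3} − ε^{2/3}|z|²)` satisfies
`max_{B} U_ε ≤ (C/|B|) ∫_B U_ε` for every ball `B ⊂ ℝ^d`, uniformly in `ε` small. -/
theorem reverse_holder_estimate
    (d : ℕ) (hd : 1 ≤ d)
    (W₀ : ℝ → ℝ) (hW₀cont : Continuous W₀)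
    (C₁ C₂ : ℝ) (hC₁ : 0 < C₁) (hC₂ : 0 < C₂)
    (hW₀low : ∀ y : ℝ, C₁ * (1 + |y|) ≤ W₀ y)
    (hW₀up : ∀ y : ℝ, W₀ y ≤ C₂ * (1 + |y|)) :
    ∃ ε₀ > (0:ℝ), ∃ C > (0:ℝ), ∀ ε : ℝ, 0 < ε → ε < ε₀ →
      ∀ z₀ : EuclideanSpace ℝ (Fin d), ∀ r : ℝ, 0 < r →
        ∀ z ∈ Metric.closedBall z₀ r,
          W₀ (ε ^ (-(2:ℝ)/3) - ε ^ ((2:ℝ)/3) * ‖z‖ ^ 2)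
            ≤ (C / (volume (Metric.closedBall z₀ r)).toReal) *
                ∫ w in Metric.closedBall z₀ r,
                  W₀ (ε ^ (-(2:ℝ)/3) - ε ^ ((2:ℝ)/3) * ‖w‖ ^ 2) := by
  set A : ℝ := 3 * ((1 / 3 : ℝ) ^ d)⁻¹ + 3 * ((2 / 3 : ℝ) ^ d)⁻¹ + 1 with hA
  refine ⟨1, one_pos, C₂ / C₁ * A, by positivity, fun ε _ _ z₀ r hr z hz => ?_⟩
  generalize ε ^ (-(2:ℝ)/3) = a
  generalize ε ^ ((2:ℝ)/3) = b
  set U : EuclideanSpace ℝ (Fin d) → ℝ := fun w => W₀ (a - b * ‖w‖ ^ 2)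
  have hUc : Continuous U := by fun_prop
  have hU0 : ∀ w, 0 ≤ U w := fun w => le_trans (by positivity) (hW₀low _)
  have hlow : ∀ w, 1 + |a - b * ‖w‖ ^ 2| ≤ U w / C₁ := fun w => by
    rw [le_div_iff₀' hC₁]; exact hW₀low _
  have hpt : ∀ w, U z ≤ C₂ / C₁ * (3 * U (z + (1 / 3 : ℝ) • (w - z))
      + 3 * U (z + (2 / 3 : ℝ) • (w - z)) + U w) := by
    intro w
    have h1 := hlow (z + (1 / 3 : ℝ) • (w - z))
    have h2 := hlow (z + (2 / 3 : ℝ) • (w - z))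
    have h3 := hlow w
    have habs : |a - b * ‖z‖ ^ 2| ≤ 3 * |a - b * ‖z + (1 / 3 : ℝ) • (w - z)‖ ^ 2|
        + 3 * |a - b * ‖z + (2 / 3 : ℝ) • (w - z)‖ ^ 2| + |a - b * ‖w‖ ^ 2| := by
      rw [sub_mul_norm_sq_eq_of_third_difference a b z w]
      refine (abs_add_le _ _).trans (add_le_add_left ((abs_sub _ _).trans ?_) _)
      simp [abs_mul]
    calc U z ≤ C₂ * (1 + |a - b * ‖z‖ ^ 2|) := hW₀up _
      _ ≤ C₂ * (3 * (U (z + (1 / 3 : ℝ) • (w - z)) / C₁)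
          + 3 * (U (z + (2 / 3 : ℝ) • (w - z)) / C₁) + U w / C₁) := by
        refine mul_le_mul_of_nonneg_left ?_ hC₂.le
        linarith
      _ = _ := by ring
  set B := closedBall z₀ r
  have hBc : IsCompact B := isCompact_closedBall z₀ r
  have hBm : MeasurableSet B := isClosed_closedBall.measurableSet
  have hBv : 0 < volume.real B :=
    ENNReal.toReal_pos (measure_closedBall_pos volume z₀ hr).ne' hBc.measure_lt_top.ne
  have hi : ∀ {f : EuclideanSpace ℝ (Fin d) → ℝ}, Continuous f → IntegrableOn f B volume :=
    fun hf => hf.continuousOn.integrableOn_compact hBc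
  have hcomp : ∀ t : ℝ, 0 < t → t ≤ 1 →
      ∫ w in B, U (z + t • (w - z)) ≤ (t ^ d)⁻¹ * ∫ w in B, U w := fun t ht ht1 => by
    simpa using setIntegral_comp_contraction_le volume (convex_closedBall z₀ r) hBm hU0 (hi hUc)
      hz ht ht1
  have i1 : IntegrableOn (fun w => 3 * U (z + (1 / 3 : ℝ) • (w - z))) B volume :=
    hi (by fun_prop)
  have i2 : IntegrableOn (fun w => 3 * U (z + (2 / 3 : ℝ) • (w - z))) B volume :=
    hi (by fun_prop)
  have hmain : volume.real B * U z ≤ C₂ / C₁ * A * ∫ w in B, U w := by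
    calc volume.real B * U z = ∫ _ in B, U z := by simp
      _ ≤ ∫ w in B, C₂ / C₁ * (3 * U (z + (1 / 3 : ℝ) • (w - z))
          + 3 * U (z + (2 / 3 : ℝ) • (w - z)) + U w) :=
        integral_mono (hi continuous_const) (hi (by fun_prop)) hpt
      _ = C₂ / C₁ * (3 * (∫ w in B, U (z + (1 / 3 : ℝ) • (w - z)))
          + 3 * (∫ w in B, U (z + (2 / 3 : ℝ) • (w - z))) + ∫ w in B, U w) := by
        rw [integral_const_mul, integral_add (hi (by fun_prop)) (hi hUc), integral_add i1 i2,
          integral_const_mul, integral_const_mul]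
      _ ≤ C₂ / C₁ * (3 * (((1 / 3 : ℝ) ^ d)⁻¹ * ∫ w in B, U w)
          + 3 * (((2 / 3 : ℝ) ^ d)⁻¹ * ∫ w in B, U w) + ∫ w in B, U w) := by
        gcongr
        · exact hcomp _ (by norm_num) (by norm_num)
        · exact hcomp _ (by norm_num) (by norm_num)
      _ = _ := by rw [hA]; ring
  change U z ≤ C₂ / C₁ * A / volume.real B * ∫ w in B, U w
  rw [div_mul_eq_mul_div, le_div_iff₀' hBv]
  exact hmain
end
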